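/- arXiv:1812.05482 — 5 statements merged into one kernel-verified Lean document; each statement's English description precedes it below -/
import Mathlib

section
/- Let (X, ρ) be a metric space, let d ≥ 1 be an integer, and let x₀, x₁, …, xₙ be points of X. Then there exist points P₀, P₁, …, Pₙ in the Euclidean space ℝ^d with ‖P_j − P_k‖ = ρ(x_j, x_k) for all 0 ≤ j, k ≤ n, while no such points exist in ℝ^(d−1), if and only if the n × n real matrix whose (j,k) entry is ρ(x₀,x_j)² + ρ(x₀,x_k)² − ρ(x_j,x_k)² is positive semidefinite and has rank equal to d. -/
theorem exists_gram_of_posSemidef_rank_le {n m : ℕ} (M : Matrix (Fin n) (Fin n) ℝ)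
    (hM : M.PosSemidef) (hr : M.rank ≤ m) :
    ∃ v : Fin n → EuclideanSpace ℝ (Fin m), ∀ j k, M j k = inner ℝ (v j) (v k) := by
  obtain ⟨q, w, hw⟩ := Matrix.posSemidef_iff_eq_sum_vecMulVec.mp hM
  let B : Matrix (Fin q) (Fin n) ℝ := Matrix.of w
  have hB : M = B.transpose * B := by
    rw [hw]
    ext j k
    simp [Matrix.sum_apply, Matrix.vecMulVec_apply, Matrix.mul_apply, B]
  have hrB : B.rank ≤ m := by
    rw [hB, Matrix.rank_transpose_mul_self] at hr
    exact hr
  let T := Matrix.toLin (Pi.basisFun ℝ (Fin n)) (EuclideanSpace.basisFun (Fin q) ℝ).toBasis B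
  have hT : Module.finrank ℝ (LinearMap.range T) ≤ m := by
    rw [Matrix.rank_eq_finrank_range_toLin B (EuclideanSpace.basisFun (Fin q) ℝ).toBasis
      (Pi.basisFun ℝ (Fin n))] at hrB
    exact hrB
  let b := stdOrthonormalBasis ℝ (LinearMap.range T)
  let e := EuclideanSpace.basisFun (Fin m) ℝ
  let f : LinearMap.range T →ₗ[ℝ] EuclideanSpace ℝ (Fin m) :=
    b.toBasis.constr ℝ (fun i => e (Fin.castLE hT i))
  have hb : Orthonormal ℝ b.toBasis := by simpa using b.orthonormal
  have hf : Orthonormal ℝ (f ∘ b.toBasis) := by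
    have : f ∘ b.toBasis = e ∘ Fin.castLE hT := by
      ext1 i
      simp only [Function.comp_apply, f, Module.Basis.constr_basis]
    rw [this]
    exact e.orthonormal.comp _ (Fin.castLE_injective hT)
  let g := f.isometryOfOrthonormal hb hf
  refine ⟨fun j => g ⟨T (Pi.single j 1), LinearMap.mem_range_self _ _⟩, fun j k => ?_⟩
  have hcol : ∀ j i, (T (Pi.single j 1)) i = B i j := by
    intro j i
    have h1 := Matrix.toLin_self (Pi.basisFun ℝ (Fin n))
      (EuclideanSpace.basisFun (Fin q) ℝ).toBasis B j
    rw [Pi.basisFun_apply] at h1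
    change T (Pi.single j 1) = _ at h1
    rw [h1]
    simp [Finset.sum_apply, Pi.single_apply]
  rw [g.inner_map_map, Submodule.coe_inner, PiLp.inner_apply, hB, Matrix.mul_apply]
  refine Finset.sum_congr rfl fun i _ => ?_
  simp only [hcol, Matrix.transpose_apply]
  simp [mul_comm]

theorem embeds_iff {X : Type*} [MetricSpace X] (m n : ℕ) (x : Fin (n + 1) → X) :
    (∃ P : Fin (n + 1) → EuclideanSpace ℝ (Fin m),
        ∀ j k, ‖P j - P k‖ = dist (x j) (x k)) ↔
    ((Matrix.of fun j k : Fin n =>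
        dist (x 0) (x j.succ) ^ 2 + dist (x 0) (x k.succ) ^ 2
          - dist (x j.succ) (x k.succ) ^ 2).PosSemidef ∧
      (Matrix.of fun j k : Fin n =>
        dist (x 0) (x j.succ) ^ 2 + dist (x 0) (x k.succ) ^ 2
          - dist (x j.succ) (x k.succ) ^ 2).rank ≤ m) := by
  have h2 : √2 * √2 = (2 : ℝ) := Real.mul_self_sqrt (by norm_num)
  constructor
  · rintro ⟨P, hP⟩
    let A : Matrix (Fin m) (Fin n) ℝ := Matrix.of fun i j => √2 * (P j.succ - P 0) i
    have hA : (Matrix.of fun j k : Fin n =>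
        dist (x 0) (x j.succ) ^ 2 + dist (x 0) (x k.succ) ^ 2
          - dist (x j.succ) (x k.succ) ^ 2) = A.conjTranspose * A := by
      ext j k
      have e1 : (A.conjTranspose * A) j k
          = 2 * inner ℝ (P j.succ - P 0) (P k.succ - P 0) := by
        rw [Matrix.mul_apply, PiLp.inner_apply, Finset.mul_sum]
        refine Finset.sum_congr rfl fun i _ => ?_
        simp only [A, Matrix.conjTranspose_apply, Matrix.of_apply, star_trivial]
        simp only [RCLike.inner_apply, conj_trivial]
        linear_combination ((P j.succ - P 0) i * (P k.succ - P 0) i) * h2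
      have e2 := norm_sub_sq_real (P j.succ - P 0) (P k.succ - P 0)
      rw [sub_sub_sub_cancel_right, hP, hP, hP] at e2
      rw [e1, Matrix.of_apply, dist_comm (x 0), dist_comm (x 0)]
      linarith
    rw [hA]
    refine ⟨Matrix.posSemidef_conjTranspose_mul_self A, ?_⟩
    rw [Matrix.rank_conjTranspose_mul_self]
    exact Matrix.rank_le_height A
  · rintro ⟨h1, hr⟩
    obtain ⟨v, hv⟩ := exists_gram_of_posSemidef_rank_le _ h1 hr
    simp only [Matrix.of_apply] at hv
    let u : Fin (n + 1) → EuclideanSpace ℝ (Fin m) := Fin.cons 0 v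
    have hu : ∀ j k, dist (x 0) (x j) ^ 2 + dist (x 0) (x k) ^ 2
        - dist (x j) (x k) ^ 2 = inner ℝ (u j) (u k) := by
      intro j k
      refine Fin.cases ?_ (fun j => ?_) j
      · simp [u]
      · refine Fin.cases ?_ (fun k => ?_) k
        · simp [u, dist_comm]
        · simpa [u] using hv j k
    refine ⟨fun j => (√2)⁻¹ • u j, fun j k => ?_⟩
    have e := norm_sub_sq_real (u j) (u k)
    rw [← real_inner_self_eq_norm_sq (u j), ← real_inner_self_eq_norm_sq (u k),
      ← hu, ← hu, ← hu] at e
    simp only [dist_self] at e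
    have e' : ‖u j - u k‖ ^ 2 = 2 * dist (x j) (x k) ^ 2 := by linarith
    rw [← smul_sub, ← sq_eq_sq₀ (norm_nonneg _) dist_nonneg, norm_smul, mul_pow, e',
      Real.norm_eq_abs, sq_abs, inv_pow, Real.sq_sqrt (by norm_num)]
    ring


/-- Schoenberg's reformulation of Menger's theorem: an `(n+1)`-tuple of points
`x₀, …, xₙ` of a metric space embeds isometrically into `ℝ^d` but not `ℝ^(d-1)`
iff the matrix `[ρ(x₀,x_j)² + ρ(x₀,x_k)² − ρ(x_j,x_k)²]` is positive
semidefinite of rank `d`. -/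
theorem stmt0 {X : Type*} [MetricSpace X] (d : ℕ) (hd : 1 ≤ d) (n : ℕ)
    (x : Fin (n + 1) → X) :
    ((∃ P : Fin (n + 1) → EuclideanSpace ℝ (Fin d),
        ∀ j k, ‖P j - P k‖ = dist (x j) (x k)) ∧
      ¬ (∃ P : Fin (n + 1) → EuclideanSpace ℝ (Fin (d - 1)),
        ∀ j k, ‖P j - P k‖ = dist (x j) (x k))) ↔
    ((Matrix.of fun j k : Fin n =>
        dist (x 0) (x j.succ) ^ 2 + dist (x 0) (x k.succ) ^ 2
          - dist (x j.succ) (x k.succ) ^ 2).PosSemidef ∧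
      (Matrix.of fun j k : Fin n =>
        dist (x 0) (x j.succ) ^ 2 + dist (x 0) (x k.succ) ^ 2
          - dist (x j.succ) (x k.succ) ^ 2).rank = d) := by
  rw [embeds_iff, embeds_iff]
  constructor
  · rintro ⟨⟨h1, h2⟩, h3⟩
    refine ⟨h1, ?_⟩
    have h4 := not_le.mp (fun h => h3 ⟨h1, h⟩)
    omega
  · rintro ⟨h1, h2⟩
    refine ⟨⟨h1, h2.le⟩, ?_⟩
    rintro ⟨-, h3⟩
    omega
end

section
/- A separable metric space (X, ρ) can be isometrically embedded into the real Hilbert space ℓ² (i.e., there exists φ : X → ℓ² with ‖φ(x) − φ(y)‖ = ρ(x,y) for all x, y) if and only if for every λ ∈ ℝ, every n ≥ 1, and every choice of points x₁, …, xₙ ∈ X, the n × n matrix whose (j,k) entry is exp(−λ² ρ(x_j, x_k)²) is positive semidefinite. -/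
open Filter Topology

/-- Quadratic-form criterion for real matrices over `Fin n`. -/
lemma psd_iff {n : ℕ} (M : Matrix (Fin n) (Fin n) ℝ) (hs : ∀ i j, M i j = M j i) :
    M.PosSemidef ↔ ∀ c : Fin n → ℝ, 0 ≤ ∑ i, ∑ j, c i * c j * M i j := by
  have hM : M.IsHermitian := by
    ext i j
    simp [hs i j]
  have key : ∀ c : Fin n → ℝ, star c ⬝ᵥ (M.mulVec c) = ∑ i, ∑ j, c i * c j * M i j := by
    intro c
    simp only [dotProduct, Matrix.mulVec, Finset.mul_sum]
    refine Finset.sum_congr rfl fun i _ => Finset.sum_congr rfl fun j _ => ?_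
    simp
    ring
  rw [Matrix.posSemidef_iff_dotProduct_mulVec]
  simp only [key, hM, true_and]

lemma psd_pow {E : Type*} [NormedAddCommGroup E] [InnerProductSpace ℝ E] {n : ℕ}
    (v : Fin n → E) (k : ℕ) :
    (Matrix.of fun i j : Fin n => (inner ℝ (v i) (v j)) ^ k).PosSemidef := by
  induction k with
  | zero =>
    rw [psd_iff _ (by simp)]
    intro c
    simp only [Matrix.of_apply, pow_zero, mul_one]
    rw [← Finset.sum_mul_sum]
    exact mul_self_nonneg _
  | succ k ih =>
    have := ih.hadamard (Matrix.posSemidef_gram ℝ v)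
    have e : (Matrix.of fun i j : Fin n => (inner ℝ (v i) (v j)) ^ (k + 1)) =
        (Matrix.of fun i j : Fin n => (inner ℝ (v i) (v j)) ^ k).hadamard (Matrix.gram ℝ v) := by
      ext i j
      simp [pow_succ]
    rw [e]
    exact this

lemma exp_inner_nonneg {E : Type*} [NormedAddCommGroup E] [InnerProductSpace ℝ E] {n : ℕ}
    (v : Fin n → E) (a : ℝ) (ha : 0 ≤ a) (c : Fin n → ℝ) :
    0 ≤ ∑ i, ∑ j, c i * c j * Real.exp (a * inner ℝ (v i) (v j)) := by
  have hs : HasSum (fun k : ℕ => ∑ i, ∑ j, c i * c j *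
      ((a * inner ℝ (v i) (v j)) ^ k / (k.factorial : ℝ)))
      (∑ i, ∑ j, c i * c j * Real.exp (a * inner ℝ (v i) (v j))) := by
    refine hasSum_sum fun i _ => hasSum_sum fun j _ => HasSum.mul_left _ ?_
    rw [Real.exp_eq_exp_ℝ]
    exact NormedSpace.expSeries_div_hasSum_exp _
  refine hs.nonneg fun k => ?_
  have h := (psd_iff _ (by intro i j; simp [real_inner_comm])).1 (psd_pow v k) c
  have : ∑ i, ∑ j, c i * c j * ((a * inner ℝ (v i) (v j)) ^ k / (k.factorial : ℝ))
      = (a ^ k / (k.factorial : ℝ)) * ∑ i, ∑ j, c i * c j *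
        (Matrix.of fun i j : Fin n => (inner ℝ (v i) (v j)) ^ k) i j := by
    simp only [Finset.mul_sum, Matrix.of_apply]
    refine Finset.sum_congr rfl fun i _ => Finset.sum_congr rfl fun j _ => ?_
    rw [mul_pow]; ring
  rw [this]
  positivity

lemma gauss_nonneg {E : Type*} [NormedAddCommGroup E] [InnerProductSpace ℝ E] {n : ℕ}
    (v : Fin n → E) (l : ℝ) (c : Fin n → ℝ) :
    0 ≤ ∑ i, ∑ j, c i * c j * Real.exp (-l ^ 2 * ‖v i - v j‖ ^ 2) := by
  have h := exp_inner_nonneg v (2 * l ^ 2) (by positivity)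
    (fun i => c i * Real.exp (-l ^ 2 * ‖v i‖ ^ 2))
  refine h.trans_eq (Finset.sum_congr rfl fun i _ => Finset.sum_congr rfl fun j _ => ?_)
  rw [norm_sub_sq_real]
  have : -l ^ 2 * (‖v i‖ ^ 2 - 2 * inner ℝ (v i) (v j) + ‖v j‖ ^ 2) =
    -l ^ 2 * ‖v i‖ ^ 2 + -l ^ 2 * ‖v j‖ ^ 2 + 2 * l ^ 2 * inner ℝ (v i) (v j) := by ring
  rw [this, Real.exp_add, Real.exp_add]
  ring

/-- Conditional negative definiteness from positivity of Gaussian kernels. -/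
lemma cnd {n : ℕ} (D : Fin n → Fin n → ℝ) (c : Fin n → ℝ) (hc : ∑ i, c i = 0)
    (h : ∀ l : ℝ, 0 ≤ ∑ i, ∑ j, c i * c j * Real.exp (-l ^ 2 * D i j)) :
    ∑ i, ∑ j, c i * c j * D i j ≤ 0 := by
  set g : ℝ → ℝ := fun s => ∑ i, ∑ j, c i * c j * Real.exp (-s * D i j) with hg
  have g0 : g 0 = 0 := by
    simp only [hg, neg_zero, zero_mul, Real.exp_zero, mul_one]
    rw [← Finset.sum_mul_sum, hc, zero_mul]
  have hd : HasDerivAt g (∑ i, ∑ j, c i * c j * (-D i j)) 0 := by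
    refine HasDerivAt.fun_sum fun i _ => HasDerivAt.fun_sum fun j _ => HasDerivAt.const_mul _ ?_
    have := (((hasDerivAt_id (0 : ℝ)).neg.mul_const (D i j))).exp
    simpa using this
  have hpos : 0 ≤ ∑ i, ∑ j, c i * c j * (-D i j) := by
    have ht := hd.tendsto_slope.mono_left (nhdsWithin_mono (0 : ℝ) (s := Set.Ioi 0)
      (fun x hx => ne_of_gt hx))
    refine ge_of_tendsto ht ?_
    filter_upwards [self_mem_nhdsWithin] with s hs
    have hs' : (0 : ℝ) < s := hs
    have := h (Real.sqrt s)
    rw [Real.sq_sqrt hs'.le] at this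
    rw [slope_def_field, g0]
    apply div_nonneg
    · simpa [hg] using this
    · linarith
  simp only [mul_neg, Finset.sum_neg_distrib] at hpos
  linarith

lemma kernel_nonneg {X : Type*} [MetricSpace X]
    (h : ∀ l : ℝ, ∀ n : ℕ, 1 ≤ n → ∀ x : Fin n → X,
      (Matrix.of fun j k : Fin n =>
        Real.exp (-l ^ 2 * dist (x j) (x k) ^ 2)).PosSemidef)
    (x₀ : X) (n : ℕ) (x : Fin n → X) (c : Fin n → ℝ) :
    0 ≤ ∑ i, ∑ j, c i * c j *
      ((dist (x i) x₀ ^ 2 + dist (x j) x₀ ^ 2 - dist (x i) (x j) ^ 2) / 2) := by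
  set y : Fin (n + 1) → X := Fin.cons x₀ x with hy
  set b : Fin (n + 1) → ℝ := Fin.cons (-∑ i, c i) c with hb
  have := cnd (fun i j => dist (y i) (y j) ^ 2) b (by simp [hb, Fin.sum_univ_succ])
    (fun l => by
      have := (psd_iff _ (by intro i j; simp [dist_comm])).1 (h l (n + 1) (by omega) y) b
      simpa using this)
  simp only [Fin.sum_univ_succ, hy, hb, Fin.cons_zero, Fin.cons_succ, dist_self] at this
  set S := ∑ i, c i with hS
  set A := ∑ i, c i * dist (x i) x₀ ^ 2 with hA
  set B := ∑ i, ∑ j, c i * c j * dist (x i) (x j) ^ 2 with hB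
  have e1 : ∑ i, -S * c i * dist x₀ (x i) ^ 2 = -S * A := by
    rw [hA, Finset.mul_sum]
    exact Finset.sum_congr rfl fun i _ => by rw [dist_comm]; ring
  have e2 : ∑ i, c i * -S * dist (x i) x₀ ^ 2 = -S * A := by
    rw [hA, Finset.mul_sum]
    exact Finset.sum_congr rfl fun i _ => by ring
  have e3 : ∑ i, ∑ j, c i * c j *
      ((dist (x i) x₀ ^ 2 + dist (x j) x₀ ^ 2 - dist (x i) (x j) ^ 2) / 2)
      = (A * S + S * A - B) / 2 := by
    rw [hA, hS, hB, Finset.sum_mul_sum, Finset.sum_mul_sum, ← Finset.sum_add_distrib,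
      ← Finset.sum_sub_distrib, Finset.sum_div]
    refine Finset.sum_congr rfl fun i _ => ?_
    rw [← Finset.sum_add_distrib, ← Finset.sum_sub_distrib, Finset.sum_div]
    exact Finset.sum_congr rfl fun j _ => by ring
  rw [Finset.sum_add_distrib, e1, e2] at this
  rw [e3]
  linarith

lemma fin_to_finset {X : Type*} (k : X → X → ℝ)
    (h : ∀ (n : ℕ) (x : Fin n → X) (c : Fin n → ℝ),
      0 ≤ ∑ i, ∑ j, c i * c j * k (x i) (x j)) (s : Finset X) (c : X → ℝ) :
    0 ≤ ∑ x ∈ s, ∑ y ∈ s, c x * c y * k x y := by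
  have := h s.card (fun i => (s.equivFin.symm i : X)) (fun i => c (s.equivFin.symm i : X))
  convert this using 1
  rw [← Finset.sum_coe_sort s, ← Equiv.sum_comp s.equivFin.symm]
  refine Finset.sum_congr rfl fun i _ => ?_
  rw [← Finset.sum_coe_sort s, ← Equiv.sum_comp s.equivFin.symm]

/-- A positive semidefinite real kernel is a Gram kernel with dense span. -/
lemma exists_gram.{u} {X : Type u} (k : X → X → ℝ) (hs : ∀ x y, k x y = k y x)
    (h : ∀ (n : ℕ) (x : Fin n → X) (c : Fin n → ℝ),
      0 ≤ ∑ i, ∑ j, c i * c j * k (x i) (x j)) :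
    ∃ (H : Type u) (_ : NormedAddCommGroup H) (_ : InnerProductSpace ℝ H) (_ : CompleteSpace H)
      (φ : X → H), (∀ x y, inner ℝ (φ x) (φ y) = k x y) ∧
        (Submodule.span ℝ (Set.range φ)).topologicalClosure = ⊤ := by
  let K : Matrix X X (ℝ →L[ℝ] ℝ) := Matrix.of fun x y => k x y • ContinuousLinearMap.id ℝ ℝ
  have hK : K.PosSemidef := by
    have T := (RKHS.posSemidef_tfae (K := K)).out 0 2
    refine T.mpr ⟨?_, fun vv => ?_⟩
    · ext x y
      have e : ContinuousLinearMap.adjoint (ContinuousLinearMap.id ℝ ℝ) =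
          ContinuousLinearMap.id ℝ ℝ := by
        exact (star_one (ℝ →L[ℝ] ℝ))
      simp [K, hs x y, ContinuousLinearMap.star_eq_adjoint, e]
    · have := fin_to_finset k h vv.support vv
      simp only [Finsupp.sum, RCLike.re_to_real]
      convert this using 4 with x _ y _
      simp [K, hs x y]
      ring
  have : Fact K.PosSemidef := ⟨hK⟩
  refine ⟨RKHS.OfKernel K, inferInstance, inferInstance, inferInstance,
    fun x => RKHS.kerFun (RKHS.OfKernel K) x 1, fun x y => ?_, ?_⟩
  · rw [← RKHS.kernel_inner, RKHS.OfKernel.kernel_ofKernel]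
    simp [K, hs x y]
  · rw [eq_top_iff, ← RKHS.kerFun_dense (RKHS.OfKernel K)]
    refine Submodule.topologicalClosure_mono (Submodule.span_le.2 ?_)
    rintro _ ⟨x, v, rfl⟩
    have : RKHS.kerFun (RKHS.OfKernel K) x v = v • RKHS.kerFun (RKHS.OfKernel K) x 1 := by
      rw [← map_smul]; simp
    rw [this]
    exact Submodule.smul_mem _ _ (Submodule.subset_span ⟨x, rfl⟩)

lemma embed_l2 (H : Type*) [NormedAddCommGroup H] [InnerProductSpace ℝ H] [CompleteSpace H]
    [TopologicalSpace.SeparableSpace H] :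
    ∃ f : H → lp (fun _ : ℕ => ℝ) 2, ∀ x y, ‖f x - f y‖ = ‖x - y‖ := by
  classical
  obtain ⟨w, b, hb⟩ := exists_hilbertBasis ℝ H
  have hw : Countable w := by
    have hball : Pairwise (Function.onFun Disjoint fun i : w => Metric.ball (b i) (1 / 2)) := by
      intro i j hij
      refine Metric.ball_disjoint_ball ?_
      have h2 : ‖b i - b j‖ ^ 2 = 2 := by
        rw [norm_sub_sq_real, b.orthonormal.1 i, b.orthonormal.1 j, b.orthonormal.2 hij]
        norm_num
      rw [dist_eq_norm]
      nlinarith [norm_nonneg (b i - b j)]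
    exact hball.countable_of_isOpen_disjoint (fun _ => Metric.isOpen_ball)
      (fun i => ⟨b i, Metric.mem_ball_self (by norm_num)⟩)
  obtain ⟨e, he⟩ := exists_injective_nat w
  have ho : Orthonormal ℝ (fun i : w => (lp.single 2 (e i) (1 : ℝ) : lp (fun _ : ℕ => ℝ) 2)) := by
    rw [orthonormal_iff_ite]
    intro i j
    rw [lp.inner_single_left]
    simp [lp.single_apply, Pi.single_apply, he.eq_iff]
  let F := ho.orthogonalFamily.linearIsometry
  refine ⟨fun x => F (b.repr x), fun x y => ?_⟩
  rw [← map_sub, ← map_sub, LinearIsometry.norm_map, LinearIsometryEquiv.norm_map]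


/-- Schoenberg: a separable metric space embeds isometrically into the real
Hilbert space ℓ² iff all the Gaussian kernels `exp(−λ² ρ(x,y)²)` are positive
semidefinite. -/
theorem stmt2 {X : Type*} [MetricSpace X] [TopologicalSpace.SeparableSpace X] :
    (∃ φ : X → lp (fun _ : ℕ => ℝ) 2, ∀ x y : X, ‖φ x - φ y‖ = dist x y) ↔
    (∀ l : ℝ, ∀ n : ℕ, 1 ≤ n → ∀ x : Fin n → X,
      (Matrix.of fun j k : Fin n =>
        Real.exp (-l ^ 2 * dist (x j) (x k) ^ 2)).PosSemidef) := by

  constructor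
  · rintro ⟨φ, hφ⟩ l n _ x
    rw [psd_iff _ (by intro i j; simp [dist_comm])]
    intro c
    have := gauss_nonneg (fun i => φ (x i)) l c
    simpa only [hφ, Matrix.of_apply] using this
  · intro h
    rcases isEmpty_or_nonempty X with hX | ⟨⟨x₀⟩⟩
    · exact ⟨fun x => isEmptyElim x, fun x => isEmptyElim x⟩
    obtain ⟨H, _, _, _, φ, hφ, hd⟩ := exists_gram
      (fun x y => (dist x x₀ ^ 2 + dist y x₀ ^ 2 - dist x y ^ 2) / 2)
      (fun x y => by rw [dist_comm x y]; ring) (kernel_nonneg h x₀)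
    have hiso : ∀ x y, ‖φ x - φ y‖ = dist x y := by
      intro x y
      have : ‖φ x - φ y‖ ^ 2 = dist x y ^ 2 := by
        rw [norm_sub_sq_real, ← real_inner_self_eq_norm_sq, ← real_inner_self_eq_norm_sq,
          hφ, hφ, hφ]
        simp
        ring
      exact (sq_eq_sq₀ (norm_nonneg _) dist_nonneg).1 this
    have hi : Isometry φ := Isometry.of_dist_eq fun x y => by rw [dist_eq_norm, hiso]
    have hsep : TopologicalSpace.SeparableSpace H := by
      have h1 := (TopologicalSpace.isSeparable_range hi.continuous).span (R := ℝ)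
      have h2 := h1.closure
      rw [← Submodule.topologicalClosure_coe, hd, Submodule.top_coe] at h2
      exact TopologicalSpace.isSeparable_univ_iff.1 h2
    obtain ⟨f, hf⟩ := embed_l2 H
    exact ⟨fun x => f (φ x), fun x y => by rw [hf, hiso]⟩
end

section
/- Let f : [−1, 1] → ℝ be a continuous function. The matrix [f(a_{jk})]_{j,k=1}^n is positive semidefinite for every n ≥ 1 and every positive semidefinite real matrix [a_{jk}]_{j,k=1}^n with all entries in [−1, 1], if and only if there exist coefficients c_k ≥ 0 for all k ≥ 0 with Σ_{k=0}^∞ c_k < ∞ such that f(x) = Σ_{k=0}^∞ c_k x^k for all x ∈ [−1, 1]. -/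
def Pres (r : ℝ) (f : ℝ → ℝ) : Prop :=
  ∀ (ι : Type) [Fintype ι] (a : ι → ι → ℝ), (∀ i j, a i j = a j i) →
    (∀ v : ι → ℝ, 0 ≤ ∑ i, ∑ j, v i * a i j * v j) → (∀ i j, |a i j| ≤ r) →
    ∀ v : ι → ℝ, 0 ≤ ∑ i, ∑ j, v i * f (a i j) * v j

def blk {ι : Type} (a b : ι → ι → ℝ) : ι ⊕ ι → ι ⊕ ι → ℝ
  | .inl i, .inl j => a i j
  | .inl i, .inr j => b i j
  | .inr i, .inl j => b i j
  | .inr i, .inr j => a i j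

lemma pres_block {r : ℝ} {f : ℝ → ℝ} (hf : Pres r f) {ι : Type} [Fintype ι] (a b : ι → ι → ℝ)
    (ha : ∀ i j, a i j = a j i) (hb : ∀ i j, b i j = b j i)
    (h1 : ∀ v : ι → ℝ, 0 ≤ ∑ i, ∑ j, v i * (a i j + b i j) * v j)
    (h2 : ∀ v : ι → ℝ, 0 ≤ ∑ i, ∑ j, v i * (a i j - b i j) * v j)
    (ra : ∀ i j, |a i j| ≤ r) (rb : ∀ i j, |b i j| ≤ r) (ε : ℝ) (hε : ε * ε = 1) (v : ι → ℝ) :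
    0 ≤ ∑ i, ∑ j, v i * (f (a i j) + ε * f (b i j)) * v j := by
  have key := hf (ι ⊕ ι) (blk a b) ?_ ?_ ?_ (Sum.elim v (fun i => ε * v i))
  · simp only [Fintype.sum_sum_type, blk, Sum.elim_inl, Sum.elim_inr] at key
    have e : 2 * ∑ i, ∑ j, v i * (f (a i j) + ε * f (b i j)) * v j
        = (∑ i, (∑ j, v i * f (a i j) * v j + ∑ j, v i * f (b i j) * (ε * v j)) +
          ∑ i, (∑ j, ε * v i * f (b i j) * v j + ∑ j, ε * v i * f (a i j) * (ε * v j))) := by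
      simp only [Finset.mul_sum, ← Finset.sum_add_distrib]
      refine Finset.sum_congr rfl fun i _ => Finset.sum_congr rfl fun j _ => ?_
      linear_combination (-(v i * v j * f (a i j))) * hε
    linarith
  · rintro (i | i) (j | j) <;> simp [blk, ha i j, hb i j]
  · intro w
    have p := h1 (fun i => w (.inl i) + w (.inr i))
    have q := h2 (fun i => w (.inl i) - w (.inr i))
    simp only [Fintype.sum_sum_type, blk]
    have e : 2 * (∑ i, (∑ j, w (.inl i) * a i j * w (.inl j) + ∑ j, w (.inl i) * b i j * w (.inr j)) +
          ∑ i, (∑ j, w (.inr i) * b i j * w (.inl j) + ∑ j, w (.inr i) * a i j * w (.inr j)))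
        = (∑ i, ∑ j, (w (.inl i) + w (.inr i)) * (a i j + b i j) * (w (.inl j) + w (.inr j))) +
          ∑ i, ∑ j, (w (.inl i) - w (.inr i)) * (a i j - b i j) * (w (.inl j) - w (.inr j)) := by
      simp only [Finset.mul_sum, ← Finset.sum_add_distrib]
      refine Finset.sum_congr rfl fun i _ => Finset.sum_congr rfl fun j _ => ?_
      ring
    linarith
  · rintro (i | i) (j | j) <;> simp [blk, ra i j, rb i j]

lemma pres_sign {f : ℝ → ℝ} (hf : Pres 1 f) (ε : ℝ) (hε : ε * ε = 1) :
    Pres 1 (fun t => f t + ε * f (-t)) := by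
  intro ι _ a ha h r v
  refine pres_block hf a (fun i j => - a i j) ha (fun i j => by rw [ha]) (by simp) ?_ r
    (by simpa using r) ε hε v
  intro w
  have := h w
  have e : ∑ i, ∑ j, w i * (a i j - -a i j) * w j = 2 * ∑ i, ∑ j, w i * a i j * w j := by
    simp only [Finset.mul_sum]
    refine Finset.sum_congr rfl fun i _ => Finset.sum_congr rfl fun j _ => ?_
    ring
  linarith

lemma pres_diff {f : ℝ → ℝ} {r h : ℝ} (hf : Pres r f) (hh : 0 ≤ h) :
    Pres (r - h) (fun t => f (t + h) - f (t - h)) := by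
  intro ι _ a ha hp hr v
  have := pres_block hf (fun i j => a i j + h) (fun i j => a i j - h)
    (fun i j => by rw [ha]) (fun i j => by rw [ha]) ?_ ?_ ?_ ?_ (-1) (by norm_num) v
  · simpa [sub_eq_add_neg] using this
  · intro w
    have := hp w
    have e : ∑ i, ∑ j, w i * (a i j + h + (a i j - h)) * w j = 2 * ∑ i, ∑ j, w i * a i j * w j := by
      simp only [Finset.mul_sum]
      refine Finset.sum_congr rfl fun i _ => Finset.sum_congr rfl fun j _ => ?_
      ring
    linarith
  · intro w
    have e : ∑ i, ∑ j, w i * (a i j + h - (a i j - h)) * w j = 2 * h * ((∑ i, w i) * ∑ j, w j) := by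
      rw [Finset.sum_mul_sum]
      simp only [Finset.mul_sum]
      refine Finset.sum_congr rfl fun i _ => Finset.sum_congr rfl fun j _ => ?_
      ring
    rw [e]
    have := mul_self_nonneg (∑ i, w i)
    positivity
  · intro i j
    have := abs_le.1 (hr i j)
    exact abs_le.2 ⟨by linarith, by linarith⟩
  · intro i j
    have := abs_le.1 (hr i j)
    exact abs_le.2 ⟨by linarith, by linarith⟩

lemma pres_iter {f : ℝ → ℝ} {h : ℝ} (hf : Pres 1 f) (hh : 0 ≤ h) (k : ℕ) :
    Pres (1 - k * h) (fun t => (fwdDiff (2 * h))^[k] f (t - k * h)) := by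
  induction k with
  | zero => simpa using hf
  | succ k ih =>
    have := pres_diff ih hh
    convert this using 1
    · push_cast; ring
    · funext t
      rw [Function.iterate_succ_apply']
      simp only [fwdDiff]
      congr 2 <;> · push_cast; ring_nf

lemma diff_nonneg {f : ℝ → ℝ} (hf : Pres 1 f) (k : ℕ) {h c : ℝ} (hh : 0 ≤ h) (hc : 0 ≤ c)
    (hk : c + k * h ≤ 1) : 0 ≤ (fwdDiff (2 * h))^[k] f (c - k * h) := by
  have := pres_iter hf hh k Unit (fun _ _ => c) (by simp)
    (fun v => by simpa using by nlinarith [mul_nonneg (mul_self_nonneg (v ())) hc])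
    (by simp [abs_of_nonneg hc]; linarith) (fun _ => 1)
  simpa using this

open Finset in
lemma bern_id (u : ℕ → ℝ) (n : ℕ) (x : ℝ) :
    ∑ k ∈ range (n + 1), n.choose k * x ^ k * (1 - x) ^ (n - k) * u k
      = ∑ k ∈ range (n + 1), (n.choose k * (fwdDiff 1)^[k] u 0) * x ^ k := by
  let E : Module.End ℝ (ℕ → ℝ) :=
    { toFun := fun u m => u (m + 1)
      map_add' := fun _ _ => rfl
      map_smul' := fun _ _ => rfl }
  have hE : ∀ k (w : ℕ → ℝ), (E ^ k) w = fun m => w (m + k) := by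
    intro k
    induction k with
    | zero => intro w; simp
    | succ k ih =>
      intro w
      rw [pow_succ, Module.End.mul_apply, ih]
      funext m
      rfl
  have hD : ∀ k (w : ℕ → ℝ), ((E - 1) ^ k) w = (fwdDiff 1)^[k] w := by
    intro k
    induction k with
    | zero => intro w; simp
    | succ k ih =>
      intro w
      rw [pow_succ, Module.End.mul_apply, ih, Function.iterate_succ_apply]
      rfl
  have key : (x • E + (1 - x) • (1 : Module.End ℝ (ℕ → ℝ))) ^ n = (x • (E - 1) + 1) ^ n := by
    congr 1
    module
  rw [Commute.add_pow, Commute.add_pow] at key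
  · have := congr_fun (LinearMap.congr_fun key u) 0
    simp only [smul_pow, one_pow, mul_one, LinearMap.sum_apply, Finset.sum_apply] at this
    convert this using 1
    · refine sum_congr rfl fun k _ => ?_
      rw [← (Nat.cast_commute (α := Module.End ℝ (ℕ → ℝ)) _ _).eq, smul_mul_smul_comm, ← nsmul_eq_mul]
      simp [hE]
      ring
    · refine sum_congr rfl fun k _ => ?_
      rw [← (Nat.cast_commute (α := Module.End ℝ (ℕ → ℝ)) _ _).eq, ← nsmul_eq_mul]
      simp [hD]
      ring
  · exact Commute.one_right _
  · exact (Commute.one_right _).smul_right _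

open Finset Filter Topology in
lemma bernstein_thm (f : ℝ → ℝ) (hf : ContinuousOn f (Set.Icc 0 1))
    (hd : ∀ n k : ℕ, 1 ≤ n → k ≤ n → 0 ≤ (fwdDiff (1 / (n : ℝ)))^[k] f 0) :
    ∃ c : ℕ → ℝ, (∀ k, 0 ≤ c k) ∧ Summable c ∧
      ∀ x ∈ Set.Icc (0 : ℝ) 1, HasSum (fun k => c k * x ^ k) (f x) := by
  let F : C(unitInterval, ℝ) := ⟨fun t => f t, continuousOn_iff_continuous_domRestrict.1 hf⟩
  let a : ℕ → ℕ → ℝ := fun n k => n.choose k * (fwdDiff 1)^[k] (fun m : ℕ => f (m / n)) 0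
  have ha0 : ∀ n k, 1 ≤ n → 0 ≤ a n k := by
    intro n k hn
    rcases le_or_gt k n with h | h
    · have := hd n k hn h
      refine mul_nonneg (by positivity) ?_
      convert! this using 1
      rw [fwdDiff_iter_eq_sum_shift, fwdDiff_iter_eq_sum_shift]
      refine sum_congr rfl fun i _ => ?_
      simp [div_eq_mul_inv]
    · simp [a, Nat.choose_eq_zero_of_lt h]
  have hB : ∀ n (x : unitInterval), bernsteinApproximation n F x
      = ∑ k ∈ range (n + 1), a n k * (x : ℝ) ^ k := by
    intro n x
    rw [bernsteinApproximation.apply, ← bern_id, ← Fin.sum_univ_eq_sum_range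
      (fun k => n.choose k * (x : ℝ) ^ k * (1 - (x : ℝ)) ^ (n - k) * f (k / n))]
    refine sum_congr rfl fun k _ => ?_
    rw [bernstein_apply, smul_eq_mul]
    rfl
  have happ : ∀ x ∈ Set.Icc (0 : ℝ) 1,
      Tendsto (fun n => ∑ k ∈ range (n + 1), a n k * x ^ k) atTop (𝓝 (f x)) := by
    intro x hx
    have h1 := bernsteinApproximation_uniform F
    have h2 := ((ContinuousEvalConst.continuous_eval_const (⟨x, hx⟩ : unitInterval)).tendsto F).comp h1
    refine h2.congr fun n => ?_
    exact hB n ⟨x, hx⟩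
  have hs1 : ∀ n, 1 ≤ n → ∑ k ∈ range (n + 1), a n k = f 1 := by
    intro n hn
    have h1 := bernsteinApproximation.apply_one (n := n) (by omega) F
    rw [hB] at h1
    have h2 : F 1 = f 1 := rfl
    rw [h2] at h1
    simpa using h1
  have ha1 : ∀ n k, 1 ≤ n → a n k ≤ f 1 := by
    intro n k hn
    rw [← hs1 n hn]
    rcases le_or_gt k n with h | h
    · exact single_le_sum (f := fun k => a n k) (fun i _ => ha0 n i hn) (by simp; omega)
    · have : a n k = 0 := by simp [a, Nat.choose_eq_zero_of_lt h]
      rw [this]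
      exact sum_nonneg fun i _ => ha0 n i hn
  have hU : (hyperfilter ℕ : Filter ℕ) ≤ atTop := Nat.hyperfilter_le_atTop
  have hev : ∀ᶠ n in (hyperfilter ℕ : Filter ℕ), 1 ≤ n := hU (eventually_ge_atTop 1)
  have hc : ∀ k, ∃ c ∈ Set.Icc 0 (f 1), Tendsto (fun n => a n k) (hyperfilter ℕ) (𝓝 c) := by
    intro k
    have := (isCompact_Icc (a := 0) (b := f 1)).ultrafilter_le_nhds'
      ((hyperfilter ℕ).map (fun n => a n k)) (by
        rw [Ultrafilter.mem_map]
        filter_upwards [hev] with n hn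
        exact ⟨ha0 n k hn, ha1 n k hn⟩)
    obtain ⟨c, h1, h2⟩ := this
    exact ⟨c, h1, h2⟩
  choose c hc hct using hc
  have hcs : Summable c := by
    refine summable_of_sum_range_le (c := f 1) (fun k => (hc k).1) fun N => ?_
    refine le_of_tendsto (tendsto_finsetSum (range N) fun k _ => hct k) ?_
    filter_upwards [hev, hU (eventually_ge_atTop N)] with n hn hN
    rw [← hs1 n hn]
    exact sum_le_sum_of_subset_of_nonneg (by intro i; simp; omega) fun i _ _ => ha0 n i hn
  have hsx : ∀ x ∈ Set.Icc (0 : ℝ) 1, Summable (fun k => c k * x ^ k) := by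
    intro x hx
    refine Summable.of_nonneg_of_le (fun k => mul_nonneg (hc k).1 (pow_nonneg hx.1 k)) (fun k => ?_) hcs
    exact mul_le_of_le_one_right (hc k).1 (pow_le_one₀ hx.1 hx.2)
  have hin : Set.EqOn f (fun x => ∑' k, c k * x ^ k) (Set.Ico 0 1) := by
    intro x hx
    have h1 := (happ x ⟨hx.1, hx.2.le⟩).mono_left hU
    have h2 : Tendsto (fun n => ∑' k, a n k * x ^ k) (hyperfilter ℕ) (𝓝 (∑' k, c k * x ^ k)) := by
      refine tendsto_tsum_of_dominated_convergence
        ((summable_geometric_of_lt_one hx.1 hx.2).mul_left (f 1)) (fun k => (hct k).mul_const _) ?_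
      filter_upwards [hev] with n hn k
      have h0 := pow_nonneg hx.1 k
      rw [Real.norm_of_nonneg (mul_nonneg (ha0 n k hn) h0)]
      exact mul_le_mul_of_nonneg_right (ha1 n k hn) h0
    refine tendsto_nhds_unique h1 (h2.congr fun n => ?_)
    refine tsum_eq_sum fun k hk => ?_
    have : n < k := by simpa using hk
    simp [a, Nat.choose_eq_zero_of_lt this]
  have hcont : ContinuousOn (fun x => ∑' k, c k * x ^ k) (Set.Icc (0 : ℝ) 1) := by
    refine continuousOn_tsum (fun k => by fun_prop) hcs fun k x hx => ?_
    rw [Real.norm_of_nonneg (mul_nonneg (hc k).1 (pow_nonneg hx.1 k))]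
    exact mul_le_of_le_one_right (hc k).1 (pow_le_one₀ hx.1 hx.2)
  have hall := hin.of_subset_closure hf hcont Set.Ico_subset_Icc_self (by
    rw [closure_Ico (by norm_num)])
  refine ⟨c, fun k => (hc k).1, hcs, fun x hx => ?_⟩
  rw [hall hx]
  exact (hsx x hx).hasSum

lemma summ_pow {c : ℕ → ℝ} (hc : ∀ k, 0 ≤ c k) (hs : Summable c) {x : ℝ} (hx : |x| ≤ 1) :
    Summable (fun k => c k * x ^ k) := by
  refine Summable.of_norm_bounded hs fun k => ?_
  rw [norm_mul, Real.norm_of_nonneg (hc k), norm_pow, Real.norm_eq_abs]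
  exact mul_le_of_le_one_right (hc k) (pow_le_one₀ (abs_nonneg x) hx)

open Finset Filter Topology in
lemma vanish (f : ℝ → ℝ) (ε : ℝ) (hε : ε * ε = 1) (hP : Pres 1 f)
    (hsym : ∀ t ∈ Set.Icc (0 : ℝ) 1, f (-t) = ε * f t) (c : ℕ → ℝ) (hc : ∀ k, 0 ≤ c k)
    (hcs : Summable c) (hs : ∀ x ∈ Set.Icc (0 : ℝ) 1, HasSum (fun k => c k * x ^ k) (f x))
    (j : ℕ) (hj : (-1 : ℝ) ^ j = -ε) : c j = 0 := by
  obtain ⟨k, hk⟩ : ∃ k, k = j + 2 := ⟨_, rfl⟩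
  have hk0 : (0 : ℝ) < k := by rw [hk]; positivity
  have hk1 : (1 : ℝ) ≤ k := by rw [hk]; push_cast; linarith [Nat.cast_nonneg (α := ℝ) j]
  have hkε : (-1 : ℝ) ^ k = -ε := by rw [hk, pow_add, hj]; norm_num
  set M : ℝ := (∑' n, c n) * (2 ^ k * (2 * k) ^ k) with hM
  have main : ∀ h : ℝ, 0 < h → 2 * k * h ≤ 1 → 2 * c j ≤ M * h ^ 2 := by
    intro h h0 h1
    have hD := diff_nonneg hP k (h := h) (c := (k - 1) * h) h0.le
      (mul_nonneg (by linarith) h0.le) (by nlinarith)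
    have hh1 : h ≤ 1 := by nlinarith
    have hpt : ((k : ℝ) - 1) * h - k * h = -h := by ring
    rw [hpt, fwdDiff_iter_eq_sum_shift] at hD
    simp only [zsmul_eq_mul, nsmul_eq_mul] at hD
    push_cast at hD
    set s : ℕ → ℝ := fun i => (-1 : ℝ) ^ (k - i) * (k.choose i) with hsdef
    let p : ℕ → ℝ := fun i => -h + i * (2 * h)
    let Dn : ℕ → ℝ := fun n => ∑ i ∈ range (k + 1), s i * p i ^ n
    have hp : ∀ i ∈ range (k + 1), |p i| ≤ 2 * k * h := by
      intro i hi
      have hi' : (i : ℝ) ≤ k := by exact_mod_cast Nat.lt_succ_iff.1 (mem_range.1 hi)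
      have : 0 ≤ (i : ℝ) := by positivity
      exact abs_le.2 ⟨by simp only [p]; nlinarith, by simp only [p]; nlinarith⟩
    have hp1 : ∀ i ∈ range (k + 1), |p i| ≤ 1 := fun i hi => (hp i hi).trans h1
    have hS : HasSum (fun n => c n * Dn n) (∑ i ∈ range (k + 1), s i * ∑' n, c n * p i ^ n) := by
      have : HasSum (fun n => ∑ i ∈ range (k + 1), s i * (c n * p i ^ n))
          (∑ i ∈ range (k + 1), s i * ∑' n, c n * p i ^ n) :=
        hasSum_sum fun i hi => ((summ_pow hc hcs (hp1 i hi)).hasSum).mul_left _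
      convert! this using 2 with n
      simp only [Dn, mul_sum]
      refine sum_congr rfl fun i _ => by ring
    have hDn0 : ∀ n, n < k → Dn n = 0 := by
      intro n hn
      have h1 := congr_fun (fwdDiff_iter_pow_eq_zero_of_lt (R := ℝ) hn) (-1 / 2)
      rw [fwdDiff_iter_eq_sum_shift] at h1
      simp only [zsmul_eq_mul, nsmul_eq_mul] at h1
      push_cast at h1
      have : Dn n = (2 * h) ^ n * ∑ i ∈ range (k + 1),
          (-1 : ℝ) ^ (k - i) * (k.choose i) * (-1 / 2 + i * 1) ^ n := by
        rw [mul_sum]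
        refine sum_congr rfl fun i _ => ?_
        have : p i = (2 * h) * (-1 / 2 + i * 1) := by simp only [p]; ring
        rw [this, mul_pow]
        ring
      rw [this, h1]
      simp
    have hDn1 : ∀ n, Dn n ≤ 2 ^ k * (2 * k * h) ^ k := by
      intro n
      rcases lt_or_ge n k with hn | hn
      · rw [hDn0 n hn]; positivity
      · calc Dn n ≤ ∑ i ∈ range (k + 1), (k.choose i : ℝ) * (2 * k * h) ^ k := by
              refine sum_le_sum fun i hi => (le_abs_self _).trans ?_
              rw [abs_mul, abs_pow]
              have e : |s i| = k.choose i := by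
                simp [hsdef, abs_mul]
              rw [e]
              refine mul_le_mul_of_nonneg_left ?_ (by positivity)
              calc |p i| ^ n ≤ |p i| ^ k := pow_le_pow_of_le_one (abs_nonneg _) (hp1 i hi) hn
                _ ≤ _ := pow_le_pow_left₀ (abs_nonneg _) (hp i hi) k
          _ = 2 ^ k * (2 * k * h) ^ k := by
              rw [← sum_mul]
              congr 1
              exact_mod_cast Nat.sum_range_choose k
    have hSle : (∑ i ∈ range (k + 1), s i * ∑' n, c n * p i ^ n) ≤ M * h ^ k := by
      have := hasSum_le (fun n => mul_le_mul_of_nonneg_left (hDn1 n) (hc n)) hS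
        (hcs.hasSum.mul_right (2 ^ k * (2 * k * h) ^ k))
      refine this.trans (le_of_eq ?_)
      rw [hM, mul_pow]
      ring
    have hhI : h ∈ Set.Icc (0 : ℝ) 1 := ⟨h0.le, hh1⟩
    have hneg := (summ_pow hc hcs (x := -h) (by rw [abs_neg, abs_of_pos h0]; exact hh1)).hasSum
    have hL := (hs h hhI).sub (hneg.mul_left ε)
    have hLj := le_hasSum hL j (fun n _ => by
      have hε2 : |ε| = 1 := by
        have := abs_mul_abs_self ε
        nlinarith [abs_nonneg ε]
      have h3 : ε * (-1) ^ n ≤ 1 := (le_abs_self _).trans (by simp [abs_mul, hε2])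
      have : c n * h ^ n - ε * (c n * (-h) ^ n) = c n * h ^ n * (1 - ε * (-1) ^ n) := by
        rw [neg_pow h]; ring
      rw [this]
      exact mul_nonneg (mul_nonneg (hc n) (pow_nonneg h0.le n)) (by linarith))
    have e1 : c j * h ^ j - ε * (c j * (-h) ^ j) = 2 * c j * h ^ j := by
      rw [neg_pow h, hj]; linear_combination (c j * h ^ j) * hε
    rw [e1] at hLj
    rw [sum_range_succ'] at hD hSle
    have e2 : ∀ i ∈ range k, s (i + 1) * ∑' n, c n * p (i + 1) ^ n
        = (-1) ^ (k - (i + 1)) * (k.choose (i + 1)) * f (-h + (↑(i + 1)) * (2 * h)) := by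
      intro i hi
      have hi2 : i + 1 ∈ range (k + 1) := by simpa using hi
      have h3 := (abs_le.1 (hp1 _ hi2)).2
      have : p (i + 1) ∈ Set.Icc (0 : ℝ) 1 := by
        refine ⟨?_, h3⟩
        simp only [p]; push_cast; nlinarith [Nat.cast_nonneg (α := ℝ) i]
      rw [(hs _ this).tsum_eq]
    rw [sum_congr rfl e2] at hSle
    have e3 : p 0 = -h := by simp [p]
    have e4 : s 0 = -ε := by simp [hsdef, hkε]
    rw [e3, e4] at hSle
    simp only [Nat.sub_zero, hkε, Nat.choose_zero_right, Nat.cast_zero, zero_mul, add_zero,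
      Nat.cast_one, mul_one, hsym h hhI] at hD
    have e5 : -ε * (ε * f h) = - f h := by linear_combination (- f h) * hε
    rw [e5] at hD
    have fin : 2 * c j * h ^ j ≤ (M * h ^ 2) * h ^ j := by
      have : M * h ^ k = (M * h ^ 2) * h ^ j := by rw [hk]; ring
      linarith
    exact le_of_mul_le_mul_right fin (pow_pos h0 j)
  have hlim : Tendsto (fun h : ℝ => M * h ^ 2) (𝓝[>] 0) (𝓝 (M * 0 ^ 2)) :=
    (Continuous.tendsto (by fun_prop) 0).mono_left nhdsWithin_le_nhds
  have := ge_of_tendsto hlim (b := 2 * c j) (by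
    filter_upwards [Ioo_mem_nhdsGT (show (0 : ℝ) < 1 / (2 * k) by positivity)] with h hh
    refine main h hh.1 ?_
    have := (lt_div_iff₀ (by positivity)).1 hh.2
    linarith)
  have := hc j
  simp at *
  linarith

lemma core (f : ℝ → ℝ) (hf : ContinuousOn f (Set.Icc (-1 : ℝ) 1)) (ε : ℝ) (hε : ε * ε = 1)
    (hP : Pres 1 f) (hsym : ∀ t, f (-t) = ε * f t) :
    ∃ c : ℕ → ℝ, (∀ k, 0 ≤ c k) ∧ Summable c ∧
      ∀ x ∈ Set.Icc (-1 : ℝ) 1, HasSum (fun k => c k * x ^ k) (f x) := by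
  obtain ⟨c, hc, hcs, h⟩ := bernstein_thm f (hf.mono (Set.Icc_subset_Icc (by norm_num) le_rfl)) (by
    intro n k hn hk
    have hn' : (0 : ℝ) < n := by exact_mod_cast hn
    have hk' : (k : ℝ) ≤ n := by exact_mod_cast hk
    have := diff_nonneg hP k (h := 1 / (2 * n)) (c := k * (1 / (2 * n))) (by positivity)
      (by positivity) (by
        have : (k : ℝ) * (1 / (2 * n)) + k * (1 / (2 * n)) = k / n := by field_simp; ring
        rw [this]
        exact (div_le_one hn').2 hk')
    rw [sub_self] at this
    convert! this using 3
    field_simp)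
  have hv := vanish f ε hε hP (fun t _ => hsym t) c hc hcs h
  refine ⟨c, hc, hcs, fun x hx => ?_⟩
  rcases le_total 0 x with h0 | h0
  · exact h x ⟨h0, hx.2⟩
  · have h1 := (h (-x) ⟨by linarith, by linarith [hx.1]⟩).mul_left ε
    rw [hsym, ← mul_assoc, hε, one_mul] at h1
    convert! h1 using 2 with n
    rw [neg_pow x]
    by_cases hn : (-1 : ℝ) ^ n = ε
    · rw [hn]; linear_combination (- c n * x ^ n) * hε
    · have : (-1 : ℝ) ^ n = -ε := by
        rcases mul_self_eq_one_iff.1 hε with rfl | rfl <;>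
        rcases neg_one_pow_eq_or ℝ n with h | h <;> simp_all
      simp [hv n this]

lemma pres_of (f : ℝ → ℝ) (h : ∀ n : ℕ, 1 ≤ n → ∀ A : Matrix (Fin n) (Fin n) ℝ, A.PosSemidef →
        (∀ j k, A j k ∈ Set.Icc (-1 : ℝ) 1) → (A.map f).PosSemidef) : Pres 1 f := by
  intro ι _ a ha hp hr v
  rcases isEmpty_or_nonempty ι with he | he
  · simp
  let e := Fintype.equivFin ι
  have key := h (Fintype.card ι) Fintype.card_pos (Matrix.of fun i j => a (e.symm i) (e.symm j))
    (by
      refine Matrix.PosSemidef.of_dotProduct_mulVec_nonneg ?_ fun x => ?_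
      · ext i j; simp [ha]
      · have := hp (fun i => x (e i))
        convert! this using 1
        simp only [dotProduct, Matrix.mulVec, Finset.mul_sum, star_trivial, Matrix.of_apply]
        rw [← e.sum_comp]
        refine Finset.sum_congr rfl fun i _ => ?_
        rw [← e.sum_comp]
        refine Finset.sum_congr rfl fun j _ => ?_
        simp; ring)
    (fun i j => abs_le.1 (hr _ _))
  have := key.dotProduct_mulVec_nonneg (fun i => v (e.symm i))
  convert! this using 1
  simp only [dotProduct, Matrix.mulVec, Finset.mul_sum, star_trivial, Matrix.of_apply]
  rw [← e.sum_comp]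
  refine Finset.sum_congr rfl fun i _ => ?_
  rw [← e.sum_comp]
  refine Finset.sum_congr rfl fun j _ => ?_
  simp; ring

lemma pow_psd {n : ℕ} (A : Matrix (Fin n) (Fin n) ℝ) (hA : A.PosSemidef) (k : ℕ) :
    (A.map (fun x => x ^ k)).PosSemidef := by
  induction k with
  | zero =>
    refine Matrix.PosSemidef.of_dotProduct_mulVec_nonneg ?_ fun x => ?_
    · ext i j; simp
    · have : star x ⬝ᵥ (A.map (fun x => x ^ 0)).mulVec x = (∑ i, x i) * ∑ i, x i := by
        simp [dotProduct, Matrix.mulVec, Finset.sum_mul]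
      rw [this]
      exact mul_self_nonneg _
  | succ k ih =>
    have := ih.hadamard hA
    convert! this using 1

/-- Schoenberg's theorem: a continuous function `f : [−1,1] → ℝ` preserves
positive semidefiniteness entrywise in all dimensions iff it is given by a
power series with non-negative summable coefficients. -/
theorem stmt3 (f : ℝ → ℝ) (hf : ContinuousOn f (Set.Icc (-1 : ℝ) 1)) :
    (∀ n : ℕ, 1 ≤ n → ∀ A : Matrix (Fin n) (Fin n) ℝ, A.PosSemidef →
        (∀ j k, A j k ∈ Set.Icc (-1 : ℝ) 1) → (A.map f).PosSemidef) ↔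
    (∃ c : ℕ → ℝ, (∀ k, 0 ≤ c k) ∧ Summable c ∧
      ∀ x ∈ Set.Icc (-1 : ℝ) 1, HasSum (fun k => c k * x ^ k) (f x)) := by
  constructor
  · intro h
    have hP := pres_of f h
    have hneg : ContinuousOn (fun t => f (-t)) (Set.Icc (-1 : ℝ) 1) :=
      hf.comp continuousOn_neg fun x hx => ⟨by linarith [hx.2], by linarith [hx.1]⟩
    obtain ⟨c, hc, hcs, h1⟩ := core (fun t => f t + 1 * f (-t)) (hf.add (continuousOn_const.mul hneg))
      1 (by norm_num) (pres_sign hP 1 (by norm_num)) (fun t => by simp; ring)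
    obtain ⟨d, hd, hds, h2⟩ := core (fun t => f t + (-1) * f (-t))
      (hf.add (continuousOn_const.mul hneg))
      (-1) (by norm_num) (pres_sign hP (-1) (by norm_num)) (fun t => by simp)
    refine ⟨fun k => 1 / 2 * (c k + d k), fun k => by have := hc k; have := hd k; positivity,
      (hcs.add hds).mul_left _, fun x hx => ?_⟩
    convert! ((h1 x hx).add (h2 x hx)).mul_left (1 / 2) using 1
    · funext k; ring
    · ring
  · rintro ⟨c, hc, hcs, h⟩ n hn A hA hr
    refine Matrix.PosSemidef.of_dotProduct_mulVec_nonneg ?_ fun x => ?_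
    · ext i j
      have := hA.1.apply i j
      simp only [star_trivial] at this
      simp [this]
    · have hs : HasSum (fun k => c k * (star x ⬝ᵥ (A.map (fun t => t ^ k)).mulVec x))
          (star x ⬝ᵥ (A.map f).mulVec x) := by
        simp only [dotProduct, Matrix.mulVec, Finset.mul_sum, star_trivial, Matrix.map_apply]
        refine hasSum_sum fun i _ => hasSum_sum fun j _ => ?_
        convert! ((h _ (hr i j)).mul_left (x i * x j)) using 1
        · funext k; ring
        · ring
      exact hs.nonneg fun k => mul_nonneg (hc k) ((pow_psd A hA k).dotProduct_mulVec_nonneg x)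
end

section
/- Let f : (−1, 1) → ℝ be a function (no continuity assumed) with the following property: for every doubly infinite real sequence (a_m)_{m∈ℤ} with all values in (−1, 1) such that the Toeplitz kernel (j,k) ↦ a_{j−k} on ℤ × ℤ is positive semidefinite (i.e., every finite matrix [a_{j_r − j_s}]_{r,s=1}^n with j₁, …, jₙ ∈ ℤ is positive semidefinite), the kernel (j,k) ↦ f(a_{j−k}) is also positive semidefinite. Then there exist coefficients c_k ≥ 0 for all k ≥ 0 such that f(x) = Σ_{k=0}^∞ c_k x^k, the series converging for all x ∈ (−1, 1). -/
def RudinHyp (f : ℝ → ℝ) : Prop := ∀ a : ℤ → ℝ, (∀ m, a m ∈ Set.Ioo (-1 : ℝ) 1) →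
      (∀ (n : ℕ) (j : Fin n → ℤ),
        (Matrix.of fun r s : Fin n => a (j r - j s)).PosSemidef) →
      (∀ (n : ℕ) (j : Fin n → ℤ),
        (Matrix.of fun r s : Fin n => f (a (j r - j s))).PosSemidef)

lemma psd_cos (n : ℕ) (j : Fin n → ℤ) (t : ℝ) :
    (Matrix.of fun r s : Fin n => Real.cos (t * ((j r - j s : ℤ) : ℝ))).PosSemidef := by
  have h1 := Matrix.posSemidef_vecMulVec_self_star (fun r : Fin n => Real.cos (t * (j r : ℝ)))
  have h2 := Matrix.posSemidef_vecMulVec_self_star (fun r : Fin n => Real.sin (t * (j r : ℝ)))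
  convert h1.add h2 using 1
  ext r s
  simp [Matrix.vecMulVec_apply, mul_sub, Real.cos_sub]

lemma psd_sum (n : ℕ) (j : Fin n → ℤ) {s p b t u v : ℝ} (hs : 0 ≤ s) (hp : 0 ≤ p) (hb : 0 ≤ b) :
    (Matrix.of fun r q : Fin n => s * Real.cos (t * ((j r - j q : ℤ) : ℝ))
      + p * Real.cos (u * ((j r - j q : ℤ) : ℝ))
      + b * Real.cos (v * ((j r - j q : ℤ) : ℝ))).PosSemidef := by
  have := (((psd_cos n j t).smul hs).add ((psd_cos n j u).smul hp)).add ((psd_cos n j v).smul hb)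
  convert this using 1
  ext r q
  simp

/-- Toeplitz matrix sum over a period. -/
lemma sum_period (N : ℕ) (g : ℤ → ℝ) (hg : ∀ m, g (m + N) = g m) (r : ℕ) :
    ∑ q ∈ Finset.range N, g ((q : ℤ) - r) = ∑ q ∈ Finset.range N, g q := by
  induction r with
  | zero => simp
  | succ r ih =>
    rw [← ih]
    rcases N with _ | N
    · simp
    rw [Finset.sum_range_succ', Finset.sum_range_succ (fun q : ℕ => g ((q : ℤ) - r))]
    congr 1
    · refine Finset.sum_congr rfl fun q _ => ?_
      congr 1; push_cast; ring
    · rw [← hg]; congr 1; push_cast; ring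

/-- Nonnegativity of discrete Fourier coefficients. -/
lemma dft_nonneg (N : ℕ) (hN : 0 < N) (g : ℤ → ℝ) (hg : ∀ m, g (m + N) = g m)
    (hpsd : ∀ (n : ℕ) (j : Fin n → ℤ), (Matrix.of fun r s : Fin n => g (j r - j s)).PosSemidef)
    (t : ℝ) (ht : ∀ m : ℤ, Real.cos (t * ((m + N : ℤ) : ℝ)) = Real.cos (t * (m : ℝ))) :
    0 ≤ ∑ m ∈ Finset.range N, g m * Real.cos (t * m) := by
  set S := ∑ m ∈ Finset.range N, g m * Real.cos (t * m) with hS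
  have key := hpsd N (fun i => (i : ℤ))
  have h1 := key.dotProduct_mulVec_nonneg (fun i => Real.cos (t * (i : ℝ)))
  have h2 := key.dotProduct_mulVec_nonneg (fun i => Real.sin (t * (i : ℝ)))
  have h3 := add_nonneg h1 h2
  have h4 : (∑ r ∈ Finset.range N, ∑ q ∈ Finset.range N,
      g ((q : ℤ) - r) * Real.cos (t * (((q : ℤ) - r : ℤ) : ℝ))) =
      N * S := by
    have : ∀ r ∈ Finset.range N, ∑ q ∈ Finset.range N,
      g ((q : ℤ) - r) * Real.cos (t * (((q : ℤ) - r : ℤ) : ℝ)) = S := fun r _ => sum_period N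
      (fun m => g m * Real.cos (t * (m : ℝ))) (fun m => by simp only [hg, ht]) r
    rw [Finset.sum_congr rfl this]
    simp
  have h5 : 0 ≤ (N : ℝ) * S := by
    rw [← h4, Finset.sum_comm]
    refine h3.trans_eq ?_
    simp only [dotProduct, Matrix.mulVec, Matrix.of_apply, Finset.mul_sum, star_trivial,
      ← Finset.sum_add_distrib]
    rw [Finset.sum_range]
    refine Finset.sum_congr rfl fun q _ => ?_
    rw [Finset.sum_range]
    refine Finset.sum_congr rfl fun r _ => ?_
    push_cast
    rw [mul_sub, Real.cos_sub]
    ring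
  exact nonneg_of_mul_nonneg_right h5 (by exact_mod_cast hN)

lemma cos_pi_int (m : ℤ) : Real.cos (Real.pi * m) = (-1 : ℝ) ^ m := by
  rw [mul_comm, Real.cos_int_mul_pi]

/-- The basic inequality. -/
lemma basic {f : ℝ → ℝ} (hf : RudinHyp f) {s p b : ℝ} (hs : 0 ≤ s) (hp : 0 ≤ p) (hb : 0 ≤ b)
    (h1 : s + p + b < 1) (M : ℕ) (hM : 0 < M) (k : ℕ) :
    0 ≤ ∑ m ∈ Finset.range (2 * M), f (s + p * (-1) ^ m + b * Real.cos (Real.pi / M * m)) *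
      Real.cos (Real.pi * k / M * m) := by
  have hM' : (M : ℝ) ≠ 0 := by positivity
  set a : ℤ → ℝ := fun m => s * Real.cos (0 * (m : ℝ)) + p * Real.cos (Real.pi * (m : ℝ))
    + b * Real.cos (Real.pi / M * (m : ℝ)) with ha
  have hmem : ∀ m, a m ∈ Set.Ioo (-1 : ℝ) 1 := by
    intro m
    have e1 := Real.cos_le_one (Real.pi * (m : ℝ))
    have e2 := Real.neg_one_le_cos (Real.pi * (m : ℝ))
    have e3 := Real.cos_le_one (Real.pi / M * (m : ℝ))
    have e4 := Real.neg_one_le_cos (Real.pi / M * (m : ℝ))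
    simp only [ha, zero_mul, Real.cos_zero, Set.mem_Ioo]
    constructor <;> nlinarith
  have hper : ∀ m, a (m + (2 * M : ℕ)) = a m := by
    intro m
    have e1 : Real.pi * ((m + (2 * M : ℕ) : ℤ) : ℝ) = Real.pi * m + (M : ℕ) * (2 * Real.pi) := by
      push_cast; ring
    have e2 : Real.pi / M * ((m + (2 * M : ℕ) : ℤ) : ℝ) = Real.pi / M * m + 2 * Real.pi := by
      push_cast; field_simp
    simp only [ha, zero_mul, e1, e2, Real.cos_add_two_pi, Real.cos_add_nat_mul_two_pi]
  have := dft_nonneg (2 * M) (by omega) (fun m => f (a m)) (fun m => by simp only [hper])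
    (hf a hmem (fun n j => psd_sum n j hs hp hb)) (Real.pi * k / M) (fun m => by
      have : Real.pi * k / M * ((m + (2 * M : ℕ) : ℤ) : ℝ)
        = Real.pi * k / M * m + k * (2 * Real.pi) := by
        push_cast; field_simp
      rw [this, Real.cos_add_nat_mul_two_pi])
  convert this using 3 with m
  · simp only [ha]
    have := cos_pi_int m
    rw [this]; simp


lemma mono_abs {f : ℝ → ℝ} (hf : RudinHyp f) {s p : ℝ} (hs : 0 ≤ s) (hp : 0 ≤ p)
    (h1 : s + p < 1) : |f (s - p)| ≤ f (s + p) := by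
  have e0 := basic hf hs hp le_rfl (by linarith) 1 one_pos 0
  have e1 := basic hf hs hp le_rfl (by linarith) 1 one_pos 1
  simp [Finset.sum_range_succ] at e0 e1
  rw [abs_le, sub_eq_add_neg]
  constructor <;> linarith

lemma mid_convex {f : ℝ → ℝ} (hf : RudinHyp f) {s b : ℝ} (hs : 0 ≤ s) (hb : 0 ≤ b)
    (h1 : s + b < 1) : 2 * f s ≤ f (s + b) + f (s - b) := by
  have e0 := basic hf hs le_rfl hb (by linarith) 2 two_pos 2
  have c2 : Real.cos (Real.pi / 2 * 2) = -1 := by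
    rw [show Real.pi / 2 * 2 = Real.pi by ring, Real.cos_pi]
  have c3 : Real.cos (Real.pi / 2 * 3) = 0 := by
    rw [show Real.pi / 2 * 3 = Real.pi / 2 + Real.pi by ring, Real.cos_add_pi]; simp
  have d1 : Real.cos (Real.pi * 2 / 2) = -1 := by
    rw [show Real.pi * 2 / 2 = Real.pi by ring, Real.cos_pi]
  have d2 : Real.cos (Real.pi * 2 / 2 * 2) = 1 := by
    rw [show Real.pi * 2 / 2 * 2 = 2 * Real.pi by ring, Real.cos_two_pi]
  have d3 : Real.cos (Real.pi * 2 / 2 * 3) = -1 := by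
    rw [show Real.pi * 2 / 2 * 3 = Real.pi + 2 * Real.pi by ring, Real.cos_add_two_pi, Real.cos_pi]
  simp only [Nat.reduceMul, Finset.sum_range_succ, Finset.sum_range_zero, Nat.cast_zero, mul_zero,
    Nat.cast_one, mul_one, Nat.cast_ofNat, c2, c3, d1, d2, d3, zero_mul, Real.cos_zero,
    Real.cos_pi_div_two, add_zero, zero_add] at e0
  rw [sub_eq_add_neg]
  simp at e0
  linarith

lemma six {f : ℝ → ℝ} (hf : RudinHyp f) {p b : ℝ} (hp : 0 ≤ p) (hb : 0 ≤ b)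
    (h1 : p + b < 1) : |f (-p + b / 2) - f (-p - b)| ≤ f (p + b) - f (p - b / 2) := by
  have e0 := basic hf le_rfl hp hb (by linarith) 3 three_pos 1
  have e1 := basic hf le_rfl hp hb (by linarith) 3 three_pos 4
  have c2 : Real.cos (Real.pi / 3 * 2) = -1 / 2 := by
    rw [show Real.pi / 3 * 2 = Real.pi - Real.pi / 3 by ring, Real.cos_pi_sub]; norm_num
  have c3 : Real.cos (Real.pi / 3 * 3) = -1 := by
    rw [show Real.pi / 3 * 3 = Real.pi by ring]; norm_num
  have c4 : Real.cos (Real.pi / 3 * 4) = -1 / 2 := by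
    rw [show Real.pi / 3 * 4 = Real.pi / 3 + Real.pi by ring, Real.cos_add_pi]; norm_num
  have c5 : Real.cos (Real.pi / 3 * 5) = 1 / 2 := by
    rw [show Real.pi / 3 * 5 = 2 * Real.pi - Real.pi / 3 by ring, Real.cos_two_pi_sub]; norm_num
  have d1 : Real.cos (Real.pi * 4 / 3) = -1 / 2 := by
    rw [show Real.pi * 4 / 3 = Real.pi / 3 + Real.pi by ring, Real.cos_add_pi]; norm_num
  have d2 : Real.cos (Real.pi * 4 / 3 * 2) = -1 / 2 := by
    rw [show Real.pi * 4 / 3 * 2 = Real.pi / 3 * 2 + 2 * Real.pi by ring, Real.cos_add_two_pi, c2]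
  have d3 : Real.cos (Real.pi * 4 / 3 * 3) = 1 := by
    rw [show Real.pi * 4 / 3 * 3 = 0 + 2 * Real.pi + 2 * Real.pi by ring, Real.cos_add_two_pi,
      Real.cos_add_two_pi, Real.cos_zero]
  have d4 : Real.cos (Real.pi * 4 / 3 * 4) = -1 / 2 := by
    rw [show Real.pi * 4 / 3 * 4 = Real.pi / 3 * 4 + 2 * Real.pi + 2 * Real.pi by ring,
      Real.cos_add_two_pi, Real.cos_add_two_pi, c4]
  have d5 : Real.cos (Real.pi * 4 / 3 * 5) = -1 / 2 := by
    rw [show Real.pi * 4 / 3 * 5 = Real.pi / 3 * 2 + 2 * Real.pi + 2 * Real.pi + 2 * Real.pi by ring,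
      Real.cos_add_two_pi, Real.cos_add_two_pi, Real.cos_add_two_pi, c2]
  simp only [Nat.reduceMul, Finset.sum_range_succ, Finset.sum_range_zero, Nat.cast_zero, mul_zero,
    Nat.cast_one, mul_one, Nat.cast_ofNat, c2, c3, c4, c5, d1, d2, d3, d4, d5, Real.cos_zero,
    Real.cos_pi_div_three, zero_add] at e0 e1
  have p2 : (-1 : ℝ) ^ 2 = 1 := by norm_num
  have p3 : (-1 : ℝ) ^ 3 = -1 := by norm_num
  have p4 : (-1 : ℝ) ^ 4 = 1 := by norm_num
  have p5 : (-1 : ℝ) ^ 5 = -1 := by norm_num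
  simp only [p2, p3, p4, p5, pow_zero, pow_one, mul_one] at e0 e1
  rw [show p * -1 + b * (1 / 2) = -p + b / 2 by ring, show p + b * (-1 / 2) = p - b / 2 by ring,
    show p * -1 + b * (-1) = -p - b by ring] at e0 e1
  rw [abs_le]
  constructor <;> linarith

lemma neg_diff {f : ℝ → ℝ} (hf : RudinHyp f) {u v : ℝ} (hv : 0 ≤ v) (hvu : v ≤ u)
    (hu : u < 1) : |f (-u) - f (-v)| ≤ f u - f v := by
  have := six hf (p := (u + 2 * v) / 3) (b := 2 * (u - v) / 3) (by linarith) (by linarith)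
    (by linarith)
  rw [abs_sub_comm]
  convert this using 3 <;> try congr 1
  all_goals ring

lemma mono_f {f : ℝ → ℝ} (hf : RudinHyp f) {u v : ℝ} (hv : 0 ≤ v) (hvu : v ≤ u)
    (hu : u < 1) : f v ≤ f u := by
  have := (abs_nonneg _).trans (neg_diff hf hv hvu hu)
  linarith

lemma diff_pow {f : ℝ → ℝ} (hf : RudinHyp f) (n : ℕ) : ∀ {x t : ℝ}, 0 ≤ x → 0 ≤ t →
    x + 2 ^ n * t < 1 → 2 ^ n * (f (x + t) - f x) ≤ f (x + 2 ^ n * t) - f x := by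
  induction n with
  | zero => intro x t _ _ _; simp
  | succ n ih =>
    intro x t hx ht h
    have hp : (0 : ℝ) < 2 ^ n := by positivity
    have hpt : 0 ≤ (2 : ℝ) ^ n * t := by positivity
    rw [pow_succ] at h ⊢
    have h1 := ih hx ht (by nlinarith)
    have h2 := mid_convex hf (s := x + 2 ^ n * t) (b := 2 ^ n * t) (by positivity) hpt (by nlinarith)
    rw [show x + 2 ^ n * t + 2 ^ n * t = x + 2 ^ n * 2 * t by ring,
      show x + 2 ^ n * t - 2 ^ n * t = x by ring] at h2
    linarith

lemma diff_le {f : ℝ → ℝ} (hf : RudinHyp f) (n : ℕ) {r R u v : ℝ} (hr : r < R) (hR : R < 1)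
    (hv : 0 ≤ v) (hvu : v ≤ u) (hu : u ≤ r) (h : 2 ^ n * (u - v) ≤ R - r) :
    f u - f v ≤ (1 / 2) ^ n * (f R - f 0) := by
  have h1 := diff_pow hf n (x := v) (t := u - v) hv (by linarith) (by linarith)
  rw [show v + (u - v) = u by ring] at h1
  have hp : (0 : ℝ) < 2 ^ n := by positivity
  have h2 : f (v + 2 ^ n * (u - v)) ≤ f R := mono_f hf (by nlinarith) (by linarith) hR
  have h3 : f 0 ≤ f v := mono_f hf le_rfl hv (by linarith)
  rw [one_div, inv_pow, inv_mul_eq_div, le_div_iff₀ hp]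
  linarith

lemma cont_f {f : ℝ → ℝ} (hf : RudinHyp f) : ContinuousOn f (Set.Ioo (-1) 1) := by
  have key : ∀ r : ℝ, 0 ≤ r → r < 1 → ∀ ε > 0, ∃ δ > 0, ∀ u v, 0 ≤ v → v ≤ u → u ≤ r → u - v < δ →
      f u - f v < ε := by
    intro r hr0 hr ε hε
    have hlim : Filter.Tendsto (fun n : ℕ => ((1 : ℝ) / 2) ^ n * (f ((1 + r) / 2) - f 0))
        Filter.atTop (nhds 0) := by
      simpa using (tendsto_pow_atTop_nhds_zero_of_lt_one (r := (1 : ℝ) / 2) (by norm_num)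
        (by norm_num)).mul_const (f ((1 + r) / 2) - f 0)
    obtain ⟨n, hn⟩ := (hlim.eventually (gt_mem_nhds hε)).exists
    refine ⟨((1 + r) / 2 - r) / 2 ^ n, div_pos (by linarith) (by positivity), ?_⟩
    intro u v hv hvu hu huv
    rw [lt_div_iff₀ (by positivity)] at huv
    exact (diff_le hf n (R := (1 + r) / 2) (by linarith) (by linarith) hv hvu hu
      (by linarith)).trans_lt hn
  have key2 : ∀ r : ℝ, 0 ≤ r → r < 1 → ∀ ε > 0, ∃ δ > 0, ∀ u v, 0 ≤ v → 0 ≤ u → u ≤ r → v ≤ r →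
      |u - v| < δ → |f u - f v| < ε ∧ |f (-u) - f (-v)| < ε := by
    intro r hr0 hr ε hε
    obtain ⟨δ, hδ, H⟩ := key r hr0 hr ε hε
    refine ⟨δ, hδ, ?_⟩
    intro u v hv hu hur hvr huv
    rw [abs_lt] at huv
    rcases le_total v u with h | h
    · have h1 := neg_diff hf hv h (by linarith)
      have h2 := mono_f hf hv h (by linarith)
      have h3 := H u v hv h hur (by linarith)
      exact ⟨by rwa [abs_of_nonneg (by linarith)], by linarith⟩
    · have h1 := neg_diff hf hu h (by linarith)
      have h2 := mono_f hf hu h (by linarith)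
      have h3 := H v u hu h hvr (by linarith)
      rw [abs_sub_comm (f u), abs_sub_comm (f (-u))]
      exact ⟨by rwa [abs_of_nonneg (by linarith)], by linarith⟩
  have key3 : ∀ r : ℝ, 0 ≤ r → r < 1 → ContinuousOn f (Set.Icc (-r) r) := by
    intro r hr0 hr
    rw [← Set.Icc_union_Icc_eq_Icc (b := 0) (by linarith) hr0]
    refine ContinuousOn.union_of_isClosed ?_ ?_ isClosed_Icc isClosed_Icc
    · rw [Metric.continuousOn_iff]
      intro x hx ε hε
      obtain ⟨δ, hδ, H⟩ := key2 r hr0 hr ε hε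
      refine ⟨δ, hδ, fun y hy hd => ?_⟩
      rw [Real.dist_eq] at hd ⊢
      have := (H (-y) (-x) (by linarith [hx.2]) (by linarith [hy.2]) (by linarith [hy.1])
        (by linarith [hx.1]) (by rwa [neg_sub_neg, abs_sub_comm])).2
      simpa using this
    · rw [Metric.continuousOn_iff]
      intro x hx ε hε
      obtain ⟨δ, hδ, H⟩ := key2 r hr0 hr ε hε
      refine ⟨δ, hδ, fun y hy hd => ?_⟩
      exact (H y x hx.1 hy.1 hy.2 hx.2 hd).1
  intro x hx
  have hx' : |x| < 1 := abs_lt.2 hx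
  have hr : |x| < (1 + |x|) / 2 := by linarith
  refine ((key3 ((1 + |x|) / 2) (by positivity) (by linarith)).continuousAt ?_).continuousWithinAt
  rw [abs_lt] at hr
  exact Icc_mem_nhds hr.1 hr.2

lemma sum_split (M : ℕ) (g : ℕ → ℝ) : ∑ m ∈ Finset.range (2 * M), g m =
    ∑ n ∈ Finset.range M, g (2 * n) + ∑ n ∈ Finset.range M, g (2 * n + 1) := by
  induction M with
  | zero => simp
  | succ M ih =>
    rw [show 2 * (M + 1) = 2 * M + 1 + 1 by ring, Finset.sum_range_succ, Finset.sum_range_succ, ih,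
      Finset.sum_range_succ, Finset.sum_range_succ]
    ring

noncomputable def trigS (M e j k : ℕ) : ℝ := ∑ n ∈ Finset.range M,
  Real.cos (Real.pi / M * (2 * n + e : ℕ)) ^ j * Real.cos (Real.pi * k / M * (2 * n + e : ℕ))

lemma trigS_zero (M e k : ℕ) (hk : 0 < k) (hkM : k < M) : trigS M e 0 k = 0 := by
  have hM : (0 : ℝ) < M := by exact_mod_cast (hk.trans hkM)
  have hk' : (0 : ℝ) < k := by exact_mod_cast hk
  have hkM' : (k : ℝ) < M := by exact_mod_cast hkM
  have hs : 0 < Real.sin (Real.pi * k / M) := by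
    apply Real.sin_pos_of_pos_of_lt_pi
    · positivity
    · rw [div_lt_iff₀ hM]
      exact mul_lt_mul_of_pos_left hkM' Real.pi_pos
  set t := Real.pi * k / M with ht
  have h : 2 * Real.sin t * trigS M e 0 k = 0 := by
    have h1 : ∀ n : ℕ, 2 * Real.sin t * (Real.cos (Real.pi / M * (2 * n + e : ℕ)) ^ 0 *
        Real.cos (t * (2 * n + e : ℕ))) =
        Real.sin (t * (2 * ((n + 1 : ℕ) : ℝ) + e - 1)) - Real.sin (t * (2 * (n : ℝ) + e - 1)) := by
      intro n
      push_cast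
      rw [show t * (2 * ((n : ℝ) + 1) + e - 1) = t * (2 * n + e) + t by ring,
        show t * (2 * (n : ℝ) + e - 1) = t * (2 * n + e) - t by ring, Real.sin_add, Real.sin_sub]
      ring
    unfold trigS
    rw [Finset.mul_sum, Finset.sum_congr rfl (fun n _ => h1 n),
      Finset.sum_range_sub (fun n : ℕ => Real.sin (t * (2 * (n : ℝ) + e - 1)))]
    have : t * (2 * (M : ℝ) + e - 1) = t * (2 * ((0 : ℕ) : ℝ) + e - 1) + k * (2 * Real.pi) := by
      rw [ht]; field_simp; push_cast; ring
    rw [this, Real.sin_add_nat_mul_two_pi, sub_self]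
  have : 2 * Real.sin t ≠ 0 := by positivity
  exact (mul_eq_zero.1 h).resolve_left this

lemma trigS_succ (M e j k : ℕ) :
    trigS M e (j + 1) (k + 1) = (trigS M e j (k + 2) + trigS M e j k) / 2 := by
  unfold trigS
  rw [← Finset.sum_add_distrib, Finset.sum_div]
  refine Finset.sum_congr rfl fun n _ => ?_
  set x : ℝ := ((2 * n + e : ℕ) : ℝ)
  set y := Real.pi * ((k + 1 : ℕ) : ℝ) / M * x with hy
  rw [show Real.pi * ((k + 2 : ℕ) : ℝ) / M * x = y + Real.pi / M * x by rw [hy]; push_cast; ring,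
    show Real.pi * (k : ℝ) / M * x = y - Real.pi / M * x by rw [hy]; push_cast; ring,
    Real.cos_add, Real.cos_sub]
  ring

lemma trigS_lt (M e : ℕ) : ∀ j k : ℕ, j < k → j + k < M → trigS M e j k = 0 := by
  intro j
  induction j with
  | zero => intro k h1 h2; exact trigS_zero M e k h1 (by omega)
  | succ j ih =>
    intro k h1 h2
    obtain ⟨k, rfl⟩ : ∃ k', k = k' + 1 := ⟨k - 1, by omega⟩
    rw [trigS_succ, ih _ (by omega) (by omega), ih _ (by omega) (by omega)]
    simp

lemma trigS_eq (M e : ℕ) : ∀ k : ℕ, 2 * k < M → trigS M e k k = M / 2 ^ k := by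
  intro k
  induction k with
  | zero => intro h; simp [trigS]
  | succ k ih =>
    intro h
    rw [trigS_succ, ih (by omega), trigS_lt _ _ _ _ (by omega) (by omega), pow_succ]
    field_simp
    simp

open Asymptotics Filter Topology in
lemma taylor_comb {H : ℝ → ℝ} (hH : ContDiff ℝ ((⊤ : ℕ∞) : WithTop ℕ∞) H) (x : ℝ) (M k : ℕ) (c w : ℕ → ℝ) (γ : ℝ)
    (h0 : ∀ j < k, ∑ n ∈ Finset.range M, c n ^ j * w n = 0)
    (h1 : ∑ n ∈ Finset.range M, c n ^ k * w n = γ) :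
    Tendsto (fun b : ℝ => (∑ n ∈ Finset.range M, H (x + b * c n) * w n) / b ^ k) (𝓝[>] 0)
      (𝓝 (γ * iteratedDeriv k H x / k.factorial)) := by
  have hT : ∀ b : ℝ, ∑ n ∈ Finset.range M,
      taylorWithinEval H k Set.univ x (x + b * c n) * w n =
      γ * iteratedDeriv k H x / k.factorial * b ^ k := by
    intro b
    simp only [taylor_within_apply, iteratedDerivWithin_univ, Finset.sum_mul]
    rw [Finset.sum_comm, Finset.sum_range_succ, Finset.sum_eq_zero, zero_add, ← h1, Finset.sum_mul,
      Finset.sum_div, Finset.sum_mul]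
    · refine Finset.sum_congr rfl fun n _ => ?_
      simp only [add_sub_cancel_left, smul_eq_mul, mul_pow]
      field_simp
    · intro j hj
      rw [Finset.mem_range] at hj
      have := h0 j hj
      calc _ = ∑ n ∈ Finset.range M, (((j.factorial : ℝ)⁻¹ * b ^ j) * iteratedDeriv j H x) *
              (c n ^ j * w n) := by
            refine Finset.sum_congr rfl fun n _ => ?_
            simp only [add_sub_cancel_left, smul_eq_mul, mul_pow]
            ring
        _ = 0 := by rw [← Finset.mul_sum, this, mul_zero]
  have hlo : (fun b : ℝ => ∑ n ∈ Finset.range M, (H (x + b * c n) -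
      taylorWithinEval H k Set.univ x (x + b * c n)) * w n) =o[𝓝[>] 0] fun b : ℝ => b ^ k := by
    suffices hsuf : ∀ n ∈ Finset.range M, (fun b : ℝ => (H (x + b * c n) -
        taylorWithinEval H k Set.univ x (x + b * c n)) * w n) =o[𝓝[>] 0] fun b : ℝ => b ^ k from
      IsLittleO.fun_sum hsuf
    intro n _
    have t1 := taylor_isLittleO_univ (x₀ := x) (f := H) (n := k) (hH.of_le (mod_cast le_top))
    have t2 : Tendsto (fun b : ℝ => x + b * c n) (𝓝[>] 0) (𝓝 x) := by
      have : Continuous (fun b : ℝ => x + b * c n) := by fun_prop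
      have := this.tendsto 0
      simp only [zero_mul, add_zero] at this
      exact this.mono_left nhdsWithin_le_nhds
    have t3 := t1.comp_tendsto t2
    have t4 : ((fun y => (y - x) ^ k) ∘ fun b : ℝ => x + b * c n) =O[𝓝[>] 0] fun b : ℝ => b ^ k := by
      refine IsBigO.of_bound (‖c n ^ k‖) (Eventually.of_forall fun b => ?_)
      simp [mul_pow, mul_comm]
    have t5 := (t3.trans_isBigO t4).const_mul_left (w n)
    simpa [mul_comm] using t5
  have hz : ∀ᶠ b : ℝ in 𝓝[>] 0, b ^ k = 0 → ∑ n ∈ Finset.range M, (H (x + b * c n) -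
      taylorWithinEval H k Set.univ x (x + b * c n)) * w n = 0 := by
    filter_upwards [self_mem_nhdsWithin] with b hb h
    exact absurd h (pow_ne_zero _ (ne_of_gt hb))
  have h2 := (isLittleO_iff_tendsto' hz).1 hlo
  have h3 := h2.add_const (γ * iteratedDeriv k H x / k.factorial)
  rw [zero_add] at h3
  refine h3.congr' ?_
  filter_upwards [self_mem_nhdsWithin] with b hb
  have hb' : b ^ k ≠ 0 := pow_ne_zero _ (ne_of_gt hb)
  simp only [sub_mul, Finset.sum_sub_distrib, hT]
  field_simp
  ring

lemma cos_shift (M k m : ℕ) (hM : 0 < M) : Real.cos (Real.pi * ((k + M : ℕ) : ℝ) / M * m) =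
    (-1) ^ m * Real.cos (Real.pi * k / M * m) := by
  have hM' : (M : ℝ) ≠ 0 := by positivity
  rw [show Real.pi * ((k + M : ℕ) : ℝ) / M * m = Real.pi * k / M * m + m * Real.pi by
    push_cast; field_simp, Real.cos_add_nat_mul_pi]

open Filter Topology in
lemma deriv_ineq {H : ℝ → ℝ} (hH : ContDiff ℝ ((⊤ : ℕ∞) : WithTop ℕ∞) H) (R : ℝ)
    (hB : ∀ p b : ℝ, 0 ≤ p → 0 ≤ b → p + b < R → ∀ M : ℕ, 0 < M → ∀ k : ℕ,
      0 ≤ ∑ m ∈ Finset.range (2 * M), H (p * (-1) ^ m + b * Real.cos (Real.pi / M * m)) *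
        Real.cos (Real.pi * k / M * m))
    (k : ℕ) (p : ℝ) (hp : 0 ≤ p) (hpR : p < R) :
    |iteratedDeriv k H (-p)| ≤ iteratedDeriv k H p := by
  set M := 2 * k + 1 with hMdef
  have hM : 0 < M := by omega
  set γ : ℝ := M / 2 ^ k with hγ
  have hγpos : 0 < γ := by positivity
  have hlim : ∀ (e : ℕ) (x : ℝ), Tendsto (fun b : ℝ => (∑ n ∈ Finset.range M,
      H (x + b * Real.cos (Real.pi / M * (2 * n + e : ℕ))) *
        Real.cos (Real.pi * k / M * (2 * n + e : ℕ))) / b ^ k) (𝓝[>] 0)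
      (𝓝 (γ * iteratedDeriv k H x / k.factorial)) := by
    intro e x
    exact taylor_comb hH x M k (fun n => Real.cos (Real.pi / M * (2 * n + e : ℕ)))
      (fun n => Real.cos (Real.pi * k / M * (2 * n + e : ℕ))) γ
      (fun j hj => trigS_lt M e j k hj (by omega)) (trigS_eq M e k (by omega))
  have hsmall : ∀ᶠ b : ℝ in 𝓝[>] 0, 0 < b ∧ p + b < R := by
    have : Set.Ioo (0 : ℝ) (R - p) ∈ 𝓝[>] (0 : ℝ) := Ioo_mem_nhdsGT (by linarith)
    filter_upwards [this] with b hb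
    exact ⟨hb.1, by linarith [hb.2]⟩
  have hpe : ∀ n : ℕ, (-1 : ℝ) ^ (2 * n) = 1 := fun n => by rw [pow_mul]; norm_num
  have hpo : ∀ n : ℕ, (-1 : ℝ) ^ (2 * n + 1) = -1 := fun n => by rw [pow_succ, hpe]; norm_num
  have l1 := (hlim 0 p).add (hlim 1 (-p))
  have l2 := (hlim 0 p).sub (hlim 1 (-p))
  have g1 := ge_of_tendsto l1 (b := 0) (by
    filter_upwards [hsmall] with b hb
    have := hB p b hp hb.1.le hb.2 M hM k
    rw [sum_split] at this
    simp only [hpe, hpo, mul_one, mul_neg] at this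
    rw [← add_div]
    exact div_nonneg this (pow_nonneg hb.1.le _))
  have g2 := ge_of_tendsto l2 (b := 0) (by
    filter_upwards [hsmall] with b hb
    have := hB p b hp hb.1.le hb.2 M hM (k + M)
    simp only [cos_shift M k _ hM] at this
    rw [sum_split] at this
    simp only [hpe, hpo, mul_one, mul_neg, one_mul, neg_mul, Finset.sum_neg_distrib,
      ← sub_eq_add_neg] at this
    rw [← sub_div]
    refine div_nonneg ?_ (pow_nonneg hb.1.le _)
    simpa using this)
  have hc : 0 < γ / k.factorial := by positivity
  rw [abs_le]
  have e1 : 0 ≤ γ / k.factorial * (iteratedDeriv k H p + iteratedDeriv k H (-p)) := by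
    exact le_of_le_of_eq g1 (by ring)
  have e2 : 0 ≤ γ / k.factorial * (iteratedDeriv k H p - iteratedDeriv k H (-p)) := by
    exact le_of_le_of_eq g2 (by ring)
  have e1' := nonneg_of_mul_nonneg_right e1 hc
  have e2' := nonneg_of_mul_nonneg_right e2 hc
  constructor <;> linarith

lemma taylorEval_eq {G : ℝ → ℝ} (hG : ContDiff ℝ ((⊤ : ℕ∞) : WithTop ℕ∞) G) (n : ℕ) {a y : ℝ}
    (hay : a ≠ y) : taylorWithinEval G n (Set.uIcc a y) a y =
      ∑ k ∈ Finset.range (n + 1), iteratedDeriv k G a / k.factorial * (y - a) ^ k := by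
  rw [taylor_within_apply]
  refine Finset.sum_congr rfl fun k _ => ?_
  have hu : UniqueDiffOn ℝ (Set.uIcc a y) := uniqueDiffOn_Icc (by
    rcases lt_or_gt_of_ne hay with h | h <;> simp [h])
  rw [iteratedDerivWithin_eq_iteratedDeriv hu (hG.contDiffAt.of_le (mod_cast le_top))
    Set.left_mem_uIcc, smul_eq_mul]
  field_simp

lemma term_bound {G : ℝ → ℝ} (hG : ContDiff ℝ ((⊤ : ℕ∞) : WithTop ℕ∞) G) {R : ℝ}
    (h : ∀ (k : ℕ) (p : ℝ), 0 ≤ p → p < R → 0 ≤ iteratedDeriv k G p) (n : ℕ)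
    {a y : ℝ} (ha : 0 ≤ a) (hay : a < y) (hy : y < R) :
    iteratedDeriv n G a / n.factorial * (y - a) ^ n ≤ G y := by
  obtain ⟨ξ, hξ, e⟩ := taylor_mean_remainder_lagrange_iteratedDeriv (f := G) (n := n) hay.ne
    (hG.of_le (mod_cast le_top)).contDiffOn
  rw [taylorEval_eq hG n hay.ne] at e
  rw [Set.uIoo_of_lt hay] at hξ
  have h1 : 0 ≤ iteratedDeriv (n + 1) G ξ * (y - a) ^ (n + 1) / ((n + 1).factorial : ℝ) := by
    have := h (n + 1) ξ (ha.trans hξ.1.le) (hξ.2.trans hy)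
    have : 0 ≤ y - a := by linarith
    positivity
  have h2 : iteratedDeriv n G a / n.factorial * (y - a) ^ n ≤
      ∑ k ∈ Finset.range (n + 1), iteratedDeriv k G a / k.factorial * (y - a) ^ k := by
    refine Finset.single_le_sum (f := fun k => iteratedDeriv k G a / k.factorial * (y - a) ^ k)
      (fun k _ => ?_) (Finset.self_mem_range_succ n)
    have := h k a ha (hay.trans hy)
    have : 0 ≤ y - a := by linarith
    positivity
  linarith

lemma remainder_bound {G : ℝ → ℝ} (hG : ContDiff ℝ ((⊤ : ℕ∞) : WithTop ℕ∞) G) {R : ℝ}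
    (h : ∀ (k : ℕ) (p : ℝ), 0 ≤ p → p < R → |iteratedDeriv k G (-p)| ≤ iteratedDeriv k G p)
    (n : ℕ) {x y : ℝ} (hx : x ≠ 0) (hxy : |x| < y) (hy : y < R) :
    |G x - ∑ k ∈ Finset.range (n + 1), iteratedDeriv k G 0 / k.factorial * x ^ k| ≤
      (n + 1) * (|x| / y) ^ n * (G y * |x| / (y - |x|)) := by
  have hpos : ∀ (k : ℕ) (p : ℝ), 0 ≤ p → p < R → 0 ≤ iteratedDeriv k G p :=
    fun k p h1 h2 => (abs_nonneg _).trans (h k p h1 h2)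
  have hxpos : 0 < |x| := abs_pos.2 hx
  obtain ⟨ξ, hξ, e⟩ := taylor_mean_remainder_cauchy (f := G) (n := n) (x := x) (x₀ := 0) hx.symm
    (hG.of_le (mod_cast le_top)).contDiffOn (by
      intro z hz
      have hu : UniqueDiffOn ℝ (Set.uIcc 0 x) := uniqueDiffOn_Icc (by
        rcases lt_or_gt_of_ne hx with h | h <;> simp [h])
      exact (((hG.contDiffOn (s := Set.uIcc 0 x)).differentiableOn_iteratedDerivWithin (m := n)
        (by exact_mod_cast WithTop.coe_lt_top n) hu) z (Set.uIoo_subset_uIcc_self hz)).mono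
          Set.uIoo_subset_uIcc_self)
  have hu : UniqueDiffOn ℝ (Set.uIcc 0 x) := uniqueDiffOn_Icc (by
    rcases lt_or_gt_of_ne hx with h | h <;> simp [h])
  rw [taylorEval_eq hG n hx.symm, iteratedDerivWithin_eq_iteratedDeriv hu
    (hG.contDiffAt.of_le (mod_cast le_top)) (Set.uIoo_subset_uIcc_self hξ)] at e
  simp only [sub_zero] at e
  rw [e]
  have hξ1 : |ξ| < |x| ∧ |x - ξ| = |x| - |ξ| := by
    rcases lt_or_gt_of_ne hx with h | h
    · rw [Set.uIoo_of_gt h] at hξ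
      rw [abs_of_neg h, abs_of_neg hξ.2, abs_of_neg (by linarith [hξ.1])]
      constructor <;> linarith [hξ.1]
    · rw [Set.uIoo_of_lt h] at hξ
      rw [abs_of_pos h, abs_of_pos hξ.1, abs_of_pos (by linarith [hξ.2])]
      constructor <;> linarith [hξ.2]
  obtain ⟨hξ1, hξ2⟩ := hξ1
  have hη := abs_nonneg ξ
  have hd : |iteratedDeriv (n + 1) G ξ| ≤ iteratedDeriv (n + 1) G |ξ| := by
    rcases le_total 0 ξ with h0 | h0
    · rw [abs_of_nonneg h0] at *
      rw [abs_of_nonneg (hpos _ _ h0 (by linarith))]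
    · have := h (n + 1) (-ξ) (by linarith) (by rw [abs_of_nonpos h0] at *; linarith)
      rwa [neg_neg, ← abs_of_nonpos h0] at this
  have hb := term_bound hG hpos (n + 1) hη (hξ1.trans hxy) hy
  have hfac : (0 : ℝ) < (n + 1).factorial := by positivity
  have hy0 : 0 < y := hxpos.trans hxy
  have hyξ : 0 < y - |ξ| := by linarith
  have hyx : 0 < y - |x| := by linarith
  have hGy : 0 ≤ G y := by simpa using hpos 0 y hy0.le hy
  rw [div_mul_eq_mul_div, div_le_iff₀ hfac, ← le_div_iff₀ (by positivity)] at hb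
  rw [abs_mul, abs_div, abs_mul, abs_pow, hξ2, Nat.abs_cast]
  have hq : (|x| - |ξ|) / (y - |ξ|) ≤ |x| / y := by
    rw [div_le_div_iff₀ hyξ hy0]; nlinarith
  have hq0 : 0 ≤ (|x| - |ξ|) / (y - |ξ|) := div_nonneg (by linarith) hyξ.le
  calc |iteratedDeriv (n + 1) G ξ| * (|x| - |ξ|) ^ n / n.factorial * |x|
      ≤ (G y * (n + 1).factorial / (y - |ξ|) ^ (n + 1)) * (|x| - |ξ|) ^ n / n.factorial * |x| := by
        have : 0 ≤ |x| - |ξ| := by linarith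
        have := hd.trans hb
        gcongr
    _ = (n + 1) * ((|x| - |ξ|) / (y - |ξ|)) ^ n * (G y * |x| / (y - |ξ|)) := by
        rw [Nat.factorial_succ, div_pow, pow_succ]
        push_cast
        field_simp
    _ ≤ (n + 1) * (|x| / y) ^ n * (G y * |x| / (y - |x|)) := by
        gcongr

open Filter Topology in
lemma power_series {G : ℝ → ℝ} (hG : ContDiff ℝ ((⊤ : ℕ∞) : WithTop ℕ∞) G) {R : ℝ}
    (h : ∀ (k : ℕ) (p : ℝ), 0 ≤ p → p < R → |iteratedDeriv k G (-p)| ≤ iteratedDeriv k G p)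
    {x : ℝ} (hx : |x| < R) :
    HasSum (fun k : ℕ => iteratedDeriv k G 0 / k.factorial * x ^ k) (G x) := by
  rcases eq_or_ne x 0 with rfl | hx0
  · convert hasSum_single (f := fun k : ℕ => iteratedDeriv k G 0 / k.factorial * (0 : ℝ) ^ k) 0 ?_
    · simp
    · intro k hk; simp [hk]
  have hpos : ∀ (k : ℕ) (p : ℝ), 0 ≤ p → p < R → 0 ≤ iteratedDeriv k G p :=
    fun k p h1 h2 => (abs_nonneg _).trans (h k p h1 h2)
  obtain ⟨y, hxy, hy⟩ := exists_between hx
  have hxpos := abs_pos.2 hx0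
  have hy0 : 0 < y := hxpos.trans hxy
  have hq0 : 0 ≤ |x| / y := by positivity
  have hq1 : |x| / y < 1 := (div_lt_one hy0).2 hxy
  have hsum : Summable (fun k : ℕ => iteratedDeriv k G 0 / k.factorial * x ^ k) := by
    refine Summable.of_norm_bounded (g := fun k => G y * (|x| / y) ^ k)
      ((summable_geometric_of_lt_one hq0 hq1).mul_left _) fun k => ?_
    have hb := term_bound hG hpos k le_rfl hy0 hy
    have h0 := hpos k 0 le_rfl (by linarith)
    rw [sub_zero, ← le_div_iff₀ (by positivity)] at hb
    rw [Real.norm_eq_abs, abs_mul, abs_pow, abs_of_nonneg (by positivity)]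
    calc _ ≤ G y / y ^ k * |x| ^ k := by gcongr
      _ = _ := by rw [div_pow]; ring
  have h1 := hsum.hasSum.tendsto_sum_nat
  have h2 : Tendsto (fun n => ∑ k ∈ Finset.range (n + 1),
      iteratedDeriv k G 0 / k.factorial * x ^ k) atTop (𝓝 (G x)) := by
    rw [tendsto_iff_norm_sub_tendsto_zero]
    refine squeeze_zero (fun _ => norm_nonneg _) (g := fun n : ℕ =>
      ((n : ℝ) + 1) * (|x| / y) ^ n * (G y * |x| / (y - |x|))) (fun n => ?_) ?_
    · rw [norm_sub_rev]
      exact remainder_bound hG h n hx0 hxy hy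
    · have t1 := tendsto_self_mul_const_pow_of_lt_one hq0 hq1
      have t2 := tendsto_pow_atTop_nhds_zero_of_lt_one hq0 hq1
      have := (t1.add t2).mul_const (G y * |x| / (y - |x|))
      simp only [add_zero, zero_mul] at this
      refine this.congr fun n => ?_
      ring
  have h3 := tendsto_nhds_unique ((tendsto_add_atTop_iff_nat 1).2 h1) h2
  rw [← h3]
  exact hsum.hasSum

open MeasureTheory in
lemma approx {f : ℝ → ℝ} (hf : RudinHyp f) {r ε : ℝ} (hr0 : 0 < r) (hr : r < 1) (hε : 0 < ε) :
    ∃ (c : ℕ → ℝ) (G : ℝ → ℝ), (∀ k, 0 ≤ c k) ∧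
      (∀ x, |x| < r → HasSum (fun k => c k * x ^ k) (G x)) ∧ ∀ x, |x| < r → |G x - f x| ≤ ε := by
  set ρ := (1 + r) / 2 with hρ
  have hρ1 : ρ < 1 := by linarith
  have hρr : r < ρ := by linarith
  have hfc : ContinuousOn f (Set.Icc (-ρ) ρ) :=
    (cont_f hf).mono fun x hx => ⟨by linarith [hx.1], by linarith [hx.2]⟩
  set F : ℝ → ℝ := Set.IccExtend (show -ρ ≤ ρ by linarith) (Set.domRestrict (Set.Icc (-ρ) ρ) f) with hF
  have hFc : Continuous F := (continuousOn_iff_continuous_domRestrict.1 hfc).Icc_extend'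
  have hFf : ∀ x, |x| ≤ ρ → F x = f x := by
    intro x hx
    rw [hF, Set.IccExtend_of_mem _ _ (abs_le.1 hx)]
    rfl
  have hunif := isCompact_Icc.uniformContinuousOn_of_continuous hfc
  rw [Metric.uniformContinuousOn_iff_le] at hunif
  obtain ⟨δ₀, hδ₀, hunif⟩ := hunif ε hε
  set δ := min δ₀ (ρ - r) / 2 with hδ
  have hδpos : 0 < δ := by
    have : 0 < min δ₀ (ρ - r) := lt_min hδ₀ (by linarith)
    linarith
  have hδ1 : 2 * δ ≤ δ₀ := by rw [hδ]; linarith [min_le_left δ₀ (ρ - r)]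
  have hδ2 : 2 * δ ≤ ρ - r := by rw [hδ]; linarith [min_le_right δ₀ (ρ - r)]
  let φ : ContDiffBump (-δ : ℝ) := ⟨δ / 2, δ, by linarith, by linarith⟩
  set w : ℝ → ℝ := φ.normed volume with hw
  have hwsupp : ∀ t, w t ≠ 0 → -(2 * δ) < t ∧ t < 0 := by
    intro t ht
    have : t ∈ Function.support (φ.normed volume) := ht
    rw [φ.support_normed_eq, Metric.mem_ball, Real.dist_eq, abs_lt] at this
    have h1 : φ.rOut = δ := rfl
    rw [h1] at this
    constructor <;> linarith [this.1, this.2]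
  have hwn : ∀ t, 0 ≤ w t := fun t => φ.nonneg_normed t
  have hwc : HasCompactSupport w := φ.hasCompactSupport_normed
  have hws : ContDiff ℝ ((⊤ : ℕ∞) : WithTop ℕ∞) w := φ.contDiff_normed
  set G : ℝ → ℝ := MeasureTheory.convolution w F (ContinuousLinearMap.lsmul ℝ ℝ) volume with hG
  have hGs : ContDiff ℝ ((⊤ : ℕ∞) : WithTop ℕ∞) G :=
    hwc.contDiff_convolution_left _ hws hFc.locallyIntegrable
  have hGeq : ∀ x, G x = ∫ t, w t * F (x - t) := fun x => rfl
  have hint : ∀ x, Integrable (fun t => w t * F (x - t)) := by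
    intro x
    refine Continuous.integrable_of_hasCompactSupport ?_ hwc.mul_right
    have := hws.continuous
    fun_prop
  have hB : ∀ p b : ℝ, 0 ≤ p → 0 ≤ b → p + b < r → ∀ M : ℕ, 0 < M → ∀ k : ℕ,
      0 ≤ ∑ m ∈ Finset.range (2 * M), G (p * (-1) ^ m + b * Real.cos (Real.pi / M * m)) *
        Real.cos (Real.pi * k / M * m) := by
    intro p b hp hb hpb M hM k
    simp only [hGeq, ← integral_mul_const]
    rw [← integral_finsetSum _ (fun m _ => (hint _).mul_const _)]
    refine integral_nonneg fun t => ?_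
    by_cases ht : w t = 0
    · simp [ht]
    obtain ⟨ht1, ht2⟩ := hwsupp t ht
    have hbas := basic hf (s := -t) (by linarith) hp hb (by linarith) M hM k
    have heq : ∀ m : ℕ, F (p * (-1) ^ m + b * Real.cos (Real.pi / M * m) - t) =
        f (-t + p * (-1) ^ m + b * Real.cos (Real.pi / M * m)) := by
      intro m
      have e3 := Real.cos_le_one (Real.pi / M * m)
      have e4 := Real.neg_one_le_cos (Real.pi / M * m)
      rw [hFf]
      · congr 1; ring
      · rw [abs_le]
        rcases neg_one_pow_eq_or ℝ m with h | h <;> rw [h] <;> constructor <;> nlinarith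
    have : (0 : ℝ) ≤ w t * ∑ m ∈ Finset.range (2 * M),
        f (-t + p * (-1) ^ m + b * Real.cos (Real.pi / M * m)) * Real.cos (Real.pi * k / M * m) :=
      mul_nonneg (hwn t) hbas
    rw [Finset.mul_sum] at this
    simp only [Pi.zero_apply, heq, mul_assoc] at this ⊢
    exact this
  have hder := deriv_ineq hGs r hB
  refine ⟨fun k => iteratedDeriv k G 0 / k.factorial, G, fun k => ?_, fun x hx => ?_, fun x hx => ?_⟩
  · have := (abs_nonneg _).trans (hder k 0 le_rfl hr0)
    positivity
  · exact power_series hGs hder hx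
  · rw [← Real.dist_eq]
    refine dist_convolution_le (R := 2 * δ) hε.le ?_ hwn φ.integral_normed
      hFc.aestronglyMeasurable ?_
    · intro t ht
      obtain ⟨h1, h2⟩ := hwsupp t ht
      rw [Metric.mem_ball, dist_zero_right, Real.norm_eq_abs, abs_lt]
      constructor <;> linarith
    · intro y hy
      rw [Metric.mem_ball, Real.dist_eq] at hy
      have hx' := abs_lt.1 hx
      have hy' := abs_lt.1 hy
      rw [hFf y (abs_le.2 ⟨by linarith, by linarith⟩)]
      refine hunif y ⟨by linarith, by linarith⟩ x ⟨by linarith, by linarith⟩ ?_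
      rw [Real.dist_eq]; linarith

open Filter Topology in
theorem stmt4 (f : ℝ → ℝ)
    (hf : ∀ a : ℤ → ℝ, (∀ m, a m ∈ Set.Ioo (-1 : ℝ) 1) →
      (∀ (n : ℕ) (j : Fin n → ℤ),
        (Matrix.of fun r s : Fin n => a (j r - j s)).PosSemidef) →
      (∀ (n : ℕ) (j : Fin n → ℤ),
        (Matrix.of fun r s : Fin n => f (a (j r - j s))).PosSemidef)) :
    ∃ c : ℕ → ℝ, (∀ k, 0 ≤ c k) ∧
      ∀ x ∈ Set.Ioo (-1 : ℝ) 1, HasSum (fun k => c k * x ^ k) (f x) := by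
  have hex : ∀ m : ℕ, ∃ (c : ℕ → ℝ) (G : ℝ → ℝ), (∀ k, 0 ≤ c k) ∧
      (∀ x, |x| < 1 - 1 / ((m : ℝ) + 2) → HasSum (fun k => c k * x ^ k) (G x)) ∧
      ∀ x, |x| < 1 - 1 / ((m : ℝ) + 2) → |G x - f x| ≤ 1 / ((m : ℝ) + 1) := by
    intro m
    refine approx hf ?_ ?_ (by positivity)
    · rw [sub_pos, div_lt_one (by positivity)]
      have : (0 : ℝ) ≤ m := by positivity
      linarith
    · have : 0 < 1 / ((m : ℝ) + 2) := by positivity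
      linarith
  choose c G hc hsum happ using hex
  have hev : ∀ x : ℝ, |x| < 1 → ∀ᶠ m : ℕ in atTop, |x| < 1 - 1 / ((m : ℝ) + 2) := by
    intro x hx
    have t0 : Tendsto (fun m : ℕ => 1 / ((m : ℝ) + 2)) atTop (𝓝 0) := by
      have := (tendsto_add_atTop_iff_nat 2).2 (tendsto_one_div_atTop_nhds_zero_nat (𝕜 := ℝ))
      simpa using this
    have t1 : Tendsto (fun m : ℕ => 1 - 1 / ((m : ℝ) + 2)) atTop (𝓝 1) := by
      simpa using t0.const_sub 1
    exact t1.eventually (lt_mem_nhds hx)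
  have hG : ∀ x : ℝ, |x| < 1 → Tendsto (fun m => G m x) atTop (𝓝 (f x)) := by
    intro x hx
    rw [tendsto_iff_norm_sub_tendsto_zero]
    refine squeeze_zero' (Eventually.of_forall fun _ => norm_nonneg _) ?_
      (tendsto_one_div_add_atTop_nhds_zero_nat (𝕜 := ℝ))
    filter_upwards [hev x hx] with m hm
    exact happ m x hm
  have hbound : ∀ y : ℝ, 0 < y → y < 1 → ∀ᶠ m : ℕ in atTop, ∀ k, c m k ≤ (f y + 1) / y ^ k := by
    intro y hy0 hy1
    have hya : |y| < 1 := by rwa [abs_of_pos hy0]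
    filter_upwards [hev y hya, (hG y hya).eventually (gt_mem_nhds (lt_add_one (f y)))] with m h1 h2 k
    rw [le_div_iff₀ (by positivity)]
    have := le_hasSum (hsum m y h1) k (fun j _ => mul_nonneg (hc m j) (by positivity))
    linarith
  let U : Ultrafilter ℕ := Ultrafilter.of atTop
  have hU : (U : Filter ℕ) ≤ atTop := Ultrafilter.of_le atTop
  have hlim : ∀ k, ∃ l : ℝ, 0 ≤ l ∧ Tendsto (fun m => c m k) U (𝓝 l) := by
    intro k
    obtain ⟨l, hl, hle⟩ := (isCompact_Icc (a := (0 : ℝ)) (b := (f (1 / 2) + 1) / (1 / 2) ^ k)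
      ).ultrafilter_le_nhds (U.map fun m => c m k) (by
        rw [le_principal_iff]
        have : ∀ᶠ m in (U : Filter ℕ), c m k ∈ Set.Icc (0 : ℝ) ((f (1 / 2) + 1) / (1 / 2) ^ k) := by
          filter_upwards [hU (hbound (1 / 2) (by norm_num) (by norm_num))] with m hm
          exact ⟨hc m k, hm k⟩
        exact this)
    exact ⟨l, hl.1, hle⟩
  choose l hl0 hl using hlim
  refine ⟨l, hl0, fun x hx => ?_⟩
  have hxa : |x| < 1 := abs_lt.2 hx
  obtain ⟨y, hxy, hy1⟩ := exists_between hxa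
  have hy0 : 0 < y := (abs_nonneg x).trans_lt hxy
  have hq0 : 0 ≤ |x| / y := by positivity
  have hq1 : |x| / y < 1 := (div_lt_one hy0).2 hxy
  have hgs : Summable fun k : ℕ => (f y + 1) * (|x| / y) ^ k :=
    (summable_geometric_of_lt_one hq0 hq1).mul_left _
  have hb : ∀ᶠ m in (U : Filter ℕ), ∀ k, ‖c m k * x ^ k‖ ≤ (f y + 1) * (|x| / y) ^ k := by
    filter_upwards [hU (hbound y hy0 hy1)] with m hm k
    rw [Real.norm_eq_abs, abs_mul, abs_pow, abs_of_nonneg (hc m k)]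
    calc _ ≤ (f y + 1) / y ^ k * |x| ^ k := by
          gcongr
          exact hm k
      _ = _ := by rw [div_pow]; ring
  have ht : ∀ k, Tendsto (fun m => c m k * x ^ k) U (𝓝 (l k * x ^ k)) :=
    fun k => (hl k).mul_const _
  have h1 := tendsto_tsum_of_dominated_convergence hgs ht hb
  have h2 : Tendsto (fun m => ∑' k, c m k * x ^ k) U (𝓝 (f x)) := by
    refine ((hG x hxa).mono_left hU).congr' ?_
    filter_upwards [hU (hev x hxa)] with m hm
    exact (hsum m x hm).tsum_eq.symm
  have h3 := tendsto_nhds_unique h1 h2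
  rw [← h3]
  refine Summable.hasSum (Summable.of_norm_bounded hgs fun k => ?_)
  refine le_of_tendsto (ht k).norm ?_
  filter_upwards [hb] with m hm
  exact hm k
end

section
/- Let D(0,1) denote the open unit disc in ℂ and let f : D(0,1) → ℂ. The entrywise map f[−] preserves positive semidefiniteness on P_n(D(0,1)) for all n ≥ 1 if and only if there exist coefficients c_{jk} ≥ 0 for all integers j, k ≥ 0 such that f(z) = Σ_{j,k ≥ 0} c_{jk} z^j (conj z)^k for all z ∈ D(0,1), the double series converging absolutely on D(0,1). -/
open scoped ComplexOrder
open Filter Topology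

namespace Herz

lemma psd_iff {ι : Type} [Fintype ι] {A : Matrix ι ι ℂ} :
    A.PosSemidef ↔ ∀ x : ι → ℂ, 0 ≤ ∑ j, ∑ k, star (x j) * A j k * x k := by
  classical
  have key : ∀ x : ι → ℂ, star x ⬝ᵥ (A.mulVec x) = ∑ j, ∑ k, star (x j) * A j k * x k := by
    intro x
    simp [dotProduct, Matrix.mulVec, Finset.mul_sum, mul_assoc]
  constructor
  · intro h x
    rw [← key]
    exact h.dotProduct_mulVec_nonneg x
  · intro h
    rw [← Matrix.isPositive_toEuclideanLin_iff, LinearMap.isPositive_iff_complex]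
    intro x
    have h1 := h x.ofLp
    rw [← key] at h1
    have h2 : inner ℂ (A.toEuclideanLin x) x = star (star x.ofLp ⬝ᵥ (A.mulVec x.ofLp)) := by
      rw [EuclideanSpace.inner_eq_star_dotProduct, Matrix.star_dotProduct, star_star]
      simp [dotProduct, mul_comm]
    rw [Complex.le_def] at h1
    rw [h2]
    constructor
    · apply Complex.ext
      · simp
      · simp at h1 ⊢
        exact h1.2.symm
    · simpa using h1.1

lemma psd_congr {ι : Type} [Fintype ι] {A B : Matrix ι ι ℂ} (hA : A.PosSemidef)
    (h : ∀ j k, A j k = B j k) : B.PosSemidef := by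
  have : A = B := by ext j k; exact h j k
  rwa [← this]

lemma psd_had {ι : Type} [Fintype ι] {A B : Matrix ι ι ℂ} (hA : A.PosSemidef)
    (hB : B.PosSemidef) : (Matrix.of fun j k => A j k * B j k).PosSemidef :=
  hA.hadamard hB

lemma psd_of_q {ι : Type} [Fintype ι] {A : Matrix ι ι ℂ}
    (h : ∀ x : ι → ℂ, 0 ≤ ∑ j, ∑ k, star (x j) * A j k * x k) : A.PosSemidef := psd_iff.2 h

/-- Compression of a block matrix. -/
lemma psd_compress {ι κ : Type} [Fintype ι] [Fintype κ] {B : Matrix (ι × κ) (ι × κ) ℂ}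
    (hB : B.PosSemidef) (y : κ → ℂ) :
    (Matrix.of fun j k => ∑ p, ∑ q, star (y p) * B (j, p) (k, q) * y q : Matrix ι ι ℂ).PosSemidef := by
  refine psd_of_q fun x => ?_
  have h := psd_iff.1 hB (fun a => x a.1 * y a.2)
  convert h using 1
  simp only [Fintype.sum_prod_type, Matrix.of_apply, Finset.mul_sum, Finset.sum_mul, star_mul']
  refine Finset.sum_congr rfl fun j _ => ?_
  rw [Finset.sum_comm]
  refine Finset.sum_congr rfl fun p _ => Finset.sum_congr rfl fun k _ =>
    Finset.sum_congr rfl fun q _ => ?_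
  ring

lemma psd_limit {ι : Type} [Fintype ι] {α : Type} {l : Filter α} [l.NeBot]
    {F : α → Matrix ι ι ℂ} {A : Matrix ι ι ℂ} (hF : ∀ᶠ a in l, (F a).PosSemidef)
    (h : ∀ j k, Tendsto (fun a => F a j k) l (𝓝 (A j k))) : A.PosSemidef := by
  refine psd_of_q fun x => ?_
  refine ge_of_tendsto (x := l) (f := fun a => ∑ j, ∑ k, star (x j) * F a j k * x k) ?_ ?_
  · refine tendsto_finsetSum _ fun j _ => tendsto_finsetSum _ fun k _ => ?_
    exact ((h j k).const_mul _).mul_const _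
  · filter_upwards [hF] with a ha using psd_iff.1 ha x

/-- Gram matrices. -/
lemma psd_gram {ι κ : Type} [Fintype ι] [Fintype κ] (v : ι → κ → ℂ) :
    (Matrix.of fun j k => ∑ i, v j i * star (v k i) : Matrix ι ι ℂ).PosSemidef := by
  have := Matrix.posSemidef_self_mul_conjTranspose (Matrix.of v)
  convert this using 1
  ext j k
  simp [Matrix.mul_apply]

lemma psd_rank_one {ι : Type} [Fintype ι] (v : ι → ℂ) :
    (Matrix.of fun j k => v j * star (v k) : Matrix ι ι ℂ).PosSemidef := by
  have := psd_gram (κ := Unit) (fun j _ => v j)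
  convert this using 1
  simp

lemma psd_tensor {ι κ : Type} [Fintype ι] [Fintype κ] {A : Matrix ι ι ℂ} {B : Matrix κ κ ℂ}
    (hA : A.PosSemidef) (hB : B.PosSemidef) :
    (Matrix.of fun p q : ι × κ => A p.1 q.1 * B p.2 q.2).PosSemidef :=
  (hA.submatrix Prod.fst).hadamard (hB.submatrix Prod.snd)

lemma psd_two {ι : Type} [Fintype ι] {A : Matrix ι ι ℂ} (hA : A.PosSemidef) (j k : ι) :
    ‖A j k‖ ^ 2 ≤ (A j j).re * (A k k).re := by
  have h := (hA.submatrix ![j, k]).det_nonneg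
  rw [Matrix.det_fin_two] at h
  simp only [Matrix.submatrix_apply, Matrix.cons_val_zero, Matrix.cons_val_one] at h
  have h1 : A k j = star (A j k) := (hA.isHermitian.apply k j).symm
  have h2 := hA.diag_nonneg (i := j)
  have h3 := hA.diag_nonneg (i := k)
  rw [Complex.le_def] at h h2 h3
  rw [h1] at h
  simp at h h2 h3
  rw [Complex.sq_norm, Complex.normSq_apply]
  rw [← h2.2, ← h3.2] at h
  linarith [h.1]

/-- `g` preserves positivity on matrices with entries in `S`. -/
def Pres (S : Set ℂ) (g : ℂ → ℂ) : Prop :=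
  ∀ n : ℕ, ∀ A : Matrix (Fin n) (Fin n) ℂ, A.PosSemidef → (∀ j k, A j k ∈ S) →
    (A.map g).PosSemidef

lemma Pres.fintype {S : Set ℂ} {g : ℂ → ℂ} (h : Pres S g) {ι : Type} [Fintype ι]
    {A : Matrix ι ι ℂ} (hA : A.PosSemidef) (hS : ∀ j k, A j k ∈ S) : (A.map g).PosSemidef := by
  have e := (Fintype.equivFin ι).symm
  have := h _ (A.submatrix e e) (hA.submatrix e) (fun j k => hS _ _)
  have h2 := this.submatrix e.symm
  convert h2 using 1
  ext i j
  simp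

end Herz

namespace Herz

/-- `f` is a nonnegative double power series on the open disc. -/
def Rep (f : ℂ → ℂ) : Prop :=
  ∃ c : ℕ → ℕ → ℝ, (∀ j k, 0 ≤ c j k) ∧
      ∀ z ∈ Metric.ball (0 : ℂ) 1,
        HasSum (fun p : ℕ × ℕ =>
          (c p.1 p.2 : ℂ) * z ^ p.1 * (starRingEnd ℂ z) ^ p.2) (f z)

lemma coeff_le {c : ℕ → ℕ → ℝ} (hc : ∀ j k, 0 ≤ c j k) {ρ : ℝ} (h0 : 0 ≤ ρ) {a : ℂ}
    (h : HasSum (fun p : ℕ × ℕ =>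
          (c p.1 p.2 : ℂ) * (ρ : ℂ) ^ p.1 * (starRingEnd ℂ (ρ : ℂ)) ^ p.2) a) (j k : ℕ) :
    c j k * ρ ^ j * ρ ^ k ≤ ‖a‖ := by
  have h1 := Complex.hasSum_re h
  have h2 : ∀ p : ℕ × ℕ, ((c p.1 p.2 : ℂ) * (ρ : ℂ) ^ p.1 * (starRingEnd ℂ (ρ : ℂ)) ^ p.2).re
      = c p.1 p.2 * ρ ^ p.1 * ρ ^ p.2 := by
    intro p
    rw [Complex.conj_ofReal]
    norm_cast
  simp_rw [h2] at h1
  have := le_hasSum h1 (j, k) (fun p _ => by have := hc p.1 p.2; positivity)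
  exact this.trans (Complex.re_le_norm a)

lemma tannery {ι : Type} (l : Ultrafilter ι) (F : ι → ℂ → ℂ) (c : ι → ℕ → ℕ → ℝ)
    (hc : ∀ i j k, 0 ≤ c i j k) (f : ℂ → ℂ)
    (hs : ∀ z ∈ Metric.ball (0 : ℂ) 1, ∀ᶠ i in (l : Filter ι),
      HasSum (fun p : ℕ × ℕ =>
          (c i p.1 p.2 : ℂ) * z ^ p.1 * (starRingEnd ℂ z) ^ p.2) (F i z))
    (ht : ∀ z ∈ Metric.ball (0 : ℂ) 1, Tendsto (fun i => F i z) l (𝓝 (f z))) : Rep f := by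
  have hb : ∀ ρ : ℝ, 0 < ρ → ρ < 1 → ∃ M : ℝ, 0 ≤ M ∧ ∀ᶠ i in (l : Filter ι), ∀ j k,
      c i j k * ρ ^ j * ρ ^ k ≤ M := by
    intro ρ h0 h1
    have hm : (ρ : ℂ) ∈ Metric.ball (0 : ℂ) 1 := by simp [abs_of_pos h0, h1]
    refine ⟨‖f ρ‖ + 1, by positivity, ?_⟩
    have h2 : ∀ᶠ i in (l : Filter ι), ‖F i ρ‖ < ‖f ρ‖ + 1 :=
      (ht _ hm).norm.eventually_lt_const (by linarith)
    filter_upwards [hs _ hm, h2] with i hi hi2 j k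
    exact (coeff_le (hc i) h0.le hi j k).trans hi2.le
  have hlim : ∀ j k, ∃ d : ℝ, Tendsto (fun i => c i j k) l (𝓝 d) := by
    intro j k
    obtain ⟨M, hM0, hM⟩ := hb (1/2) (by norm_num) (by norm_num)
    have : ∀ᶠ i in (l : Filter ι), c i j k ∈ Set.Icc 0 (M / ((1/2) ^ j * (1/2) ^ k)) := by
      filter_upwards [hM] with i hi
      refine ⟨hc i j k, ?_⟩
      rw [le_div_iff₀ (by positivity), ← mul_assoc]
      exact hi j k
    obtain ⟨d, -, hd⟩ := (isCompact_Icc (a := (0:ℝ))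
      (b := M / ((1/2) ^ j * (1/2) ^ k))).ultrafilter_le_nhds (l.map fun i => c i j k)
      (by rw [le_principal_iff]; exact this)
    exact ⟨d, hd⟩
  choose d hd using hlim
  refine ⟨d, fun j k => ge_of_tendsto (hd j k) (Eventually.of_forall fun i => hc i j k), ?_⟩
  intro z hz
  have hz1 : ‖z‖ < 1 := by simpa using hz
  obtain ⟨ρ, hρ1, hρ2⟩ := exists_between hz1
  have hρ0 : 0 < ρ := (norm_nonneg z).trans_lt hρ1
  obtain ⟨M, hM0, hM⟩ := hb ρ hρ0 hρ2
  have hq0 : 0 ≤ ‖z‖ / ρ := by positivity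
  have hq1 : ‖z‖ / ρ < 1 := by rwa [div_lt_one hρ0]
  have hsum : Summable (fun p : ℕ × ℕ => M * ((‖z‖ / ρ) ^ p.1 * (‖z‖ / ρ) ^ p.2)) := by
    refine Summable.mul_left _ ?_
    exact Summable.mul_of_nonneg (summable_geometric_of_lt_one hq0 hq1)
      (summable_geometric_of_lt_one hq0 hq1) (fun _ => by positivity) (fun _ => by positivity)
  have hbd : ∀ᶠ i in (l : Filter ι), ∀ p : ℕ × ℕ,
      ‖(c i p.1 p.2 : ℂ) * z ^ p.1 * (starRingEnd ℂ z) ^ p.2‖ ≤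
        M * ((‖z‖ / ρ) ^ p.1 * (‖z‖ / ρ) ^ p.2) := by
    filter_upwards [hM] with i hi p
    have h1 := hi p.1 p.2
    rw [norm_mul, norm_mul, norm_pow, norm_pow, RCLike.norm_conj, Complex.norm_real,
      Real.norm_of_nonneg (hc i _ _)]
    have h2 : c i p.1 p.2 * ‖z‖ ^ p.1 * ‖z‖ ^ p.2 =
      (c i p.1 p.2 * ρ ^ p.1 * ρ ^ p.2) * ((‖z‖ / ρ) ^ p.1 * (‖z‖ / ρ) ^ p.2) := by
      rw [div_pow, div_pow]
      field_simp
    rw [h2]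
    exact mul_le_mul_of_nonneg_right h1 (by positivity)
  have hpt : ∀ p : ℕ × ℕ, Tendsto (fun i => (c i p.1 p.2 : ℂ) * z ^ p.1 * (starRingEnd ℂ z) ^ p.2)
      l (𝓝 ((d p.1 p.2 : ℂ) * z ^ p.1 * (starRingEnd ℂ z) ^ p.2)) := by
    intro p
    refine Tendsto.mul_const _ (Tendsto.mul_const _ ?_)
    exact (Complex.continuous_ofReal.tendsto _).comp (hd _ _)
  have hT := tendsto_tsum_of_dominated_convergence hsum hpt hbd
  have hT2 := ht z hz
  have heq : f z = ∑' p : ℕ × ℕ, (d p.1 p.2 : ℂ) * z ^ p.1 * (starRingEnd ℂ z) ^ p.2 := by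
    refine tendsto_nhds_unique hT2 (hT.congr' ?_)
    filter_upwards [hs z hz] with i hi using hi.tsum_eq
  rw [heq]
  refine Summable.hasSum (Summable.of_norm_bounded hsum fun p => ?_)
  exact le_of_tendsto (hpt p).norm (hbd.mono fun i hi => hi p)

lemma Rep.convex : Convex ℝ {f | Rep f} := by
  rintro f ⟨c, hc, hf⟩ g ⟨d, hd, hg⟩ a b ha hb _
  refine ⟨fun j k => a * c j k + b * d j k, fun j k => ?_, fun z hz => ?_⟩
  · have := hc j k
    have := hd j k
    positivity
  · have := ((hf z hz).mul_left (a : ℂ)).add ((hg z hz).mul_left (b : ℂ))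
    have e : (a • f + b • g) z = (a : ℂ) * f z + b * g z := by simp
    rw [e]
    have e2 : (fun p : ℕ × ℕ => ((a * c p.1 p.2 + b * d p.1 p.2 : ℝ) : ℂ) * z ^ p.1 *
        (starRingEnd ℂ z) ^ p.2) = fun p : ℕ × ℕ =>
        (a : ℂ) * ((c p.1 p.2 : ℂ) * z ^ p.1 * (starRingEnd ℂ z) ^ p.2) +
        (b : ℂ) * ((d p.1 p.2 : ℂ) * z ^ p.1 * (starRingEnd ℂ z) ^ p.2) := by
      funext p
      push_cast
      ring
    rw [e2]
    exact this

/-- Converse direction. -/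
lemma Rep.pres {f : ℂ → ℂ} (hf : Rep f) : Pres (Metric.ball 0 1) f := by
  obtain ⟨c, hc, h⟩ := hf
  intro n A hA hAS
  have hpow : ∀ B : Matrix (Fin n) (Fin n) ℂ, B.PosSemidef → ∀ m : ℕ,
      (B.map (fun z => z ^ m)).PosSemidef := by
    intro B hB m
    induction m with
    | zero =>
      have := psd_rank_one (fun _ : Fin n => (1 : ℂ))
      exact psd_congr this fun j k => by simp
    | succ m ih =>
      exact psd_congr (psd_had ih hB) fun j k => by simp [pow_succ]
  have hterm : ∀ p : ℕ × ℕ, (A.map fun z =>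
      (c p.1 p.2 : ℂ) * z ^ p.1 * (starRingEnd ℂ z) ^ p.2).PosSemidef := by
    intro p
    have h1 := (psd_had (hpow A hA p.1) (hpow _ hA.transpose p.2)).smul
      (a := (c p.1 p.2 : ℂ)) (by exact_mod_cast hc _ _)
    refine psd_congr h1 fun j k => ?_
    have := hA.isHermitian.apply k j
    simp [← this, mul_assoc]
  refine psd_limit (l := (atTop : Filter (Finset (ℕ × ℕ)))) (F := fun s => ∑ p ∈ s, (A.map fun z =>
      (c p.1 p.2 : ℂ) * z ^ p.1 * (starRingEnd ℂ z) ^ p.2)) (Eventually.of_forall fun s =>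
      Matrix.posSemidef_sum _ fun p _ => hterm p) fun j k => ?_
  have := h (A j k) (hAS j k)
  simpa [HasSum, Matrix.sum_apply] using this

end Herz

namespace Herz

/-- The closed unit disc. -/
abbrev CD : Set ℂ := Metric.closedBall (0 : ℂ) 1

lemma mem_CD {z : ℂ} : z ∈ CD ↔ ‖z‖ ≤ 1 := by simp

lemma psd_two_by_two {w : ℂ} (hw : ‖w‖ ≤ 1) :
    (!![1, w; starRingEnd ℂ w, 1] : Matrix (Fin 2) (Fin 2) ℂ).PosSemidef := by
  refine psd_congr (psd_gram ![![1, 0], ![starRingEnd ℂ w, (√(1 - ‖w‖ ^ 2) : ℝ)]]) ?_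
  have h : ((√(1 - ‖w‖ ^ 2) : ℝ) : ℂ) * (√(1 - ‖w‖ ^ 2) : ℝ) = 1 - (‖w‖ : ℂ) ^ 2 := by
    rw [← Complex.ofReal_mul, Real.mul_self_sqrt (by nlinarith [norm_nonneg w])]
    push_cast; ring
  intro j k
  fin_cases j <;> fin_cases k <;> simp
  rw [h, ← Complex.conj_mul']
  ring

lemma entries_two {w : ℂ} (hw : ‖w‖ ≤ 1) (j k : Fin 2) :
    ‖(!![1, w; starRingEnd ℂ w, 1] : Matrix (Fin 2) (Fin 2) ℂ) j k‖ ≤ 1 := by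
  fin_cases j <;> fin_cases k <;> simp [hw]

lemma Pres.two {g : ℂ → ℂ} (h : Pres CD g) {w : ℂ} (hw : ‖w‖ ≤ 1) :
    0 ≤ (g 1).re ∧ (g 1).im = 0 ∧ ‖g w‖ ≤ (g 1).re ∧ g (starRingEnd ℂ w) = starRingEnd ℂ (g w) := by
  have h1 := h.fintype (psd_two_by_two hw) (fun j k => mem_CD.2 (entries_two hw j k))
  have h2 := psd_two h1 0 1
  have h3 := h1.diag_nonneg (i := 0)
  have h4 := h1.isHermitian.apply 1 0
  simp at h2 h3 h4
  rw [Complex.le_def] at h3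
  simp at h3
  refine ⟨h3.1, h3.2.symm, ?_, h4.symm⟩
  exact abs_le_of_sq_le_sq' (by nlinarith) h3.1 |>.2

/-- The compact convex set of normalised preservers. -/
def K : Set (ℂ → ℂ) := {g | Pres CD g ∧ g 1 = 1 ∧ ∀ z, 1 < ‖z‖ → g z = 0}

lemma K_norm_le {g : ℂ → ℂ} (hg : g ∈ K) (z : ℂ) : ‖g z‖ ≤ 1 := by
  by_cases hz : ‖z‖ ≤ 1
  · have := (hg.1.two hz).2.2.1
    simpa [hg.2.1] using this
  · rw [hg.2.2 z (not_le.1 hz)]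
    simp

lemma K_compact : IsCompact K := by
  have h1 : IsCompact (Set.univ.pi fun _ : ℂ => Metric.closedBall (0 : ℂ) 1) :=
    isCompact_univ_pi fun _ => isCompact_closedBall _ _
  refine h1.of_isClosed_subset ?_ ?_
  · have e : K = {g | Pres CD g} ∩ ({g | g 1 = 1} ∩ ⋂ z : ℂ, ⋂ _ : 1 < ‖z‖, {g | g z = 0}) := by
      ext g
      simp [K]
    rw [e]
    refine IsClosed.inter ?_ (IsClosed.inter ?_ ?_)
    · have e2 : {g | Pres CD g} = ⋂ n : ℕ, ⋂ A : Matrix (Fin n) (Fin n) ℂ, ⋂ _ : A.PosSemidef,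
          ⋂ _ : (∀ j k, A j k ∈ CD), ⋂ x : Fin n → ℂ,
            {g : ℂ → ℂ | 0 ≤ ∑ j, ∑ k, star (x j) * g (A j k) * x k} := by
        ext g
        simp only [Set.mem_ofPred_eq, Set.mem_iInter, Pres]
        simp only [psd_iff (A := Matrix.map _ g), Matrix.map_apply]
      rw [e2]
      refine isClosed_iInter fun n => isClosed_iInter fun A => isClosed_iInter fun _ =>
        isClosed_iInter fun _ => isClosed_iInter fun x => ?_
      exact isClosed_le continuous_const (by fun_prop)
    · exact isClosed_eq (continuous_apply _) continuous_const
    · exact isClosed_iInter fun z => isClosed_iInter fun _ =>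
        isClosed_eq (continuous_apply _) continuous_const
  · intro g hg z _
    simpa using K_norm_le hg z

lemma Pres.add_smul {S : Set ℂ} {g h : ℂ → ℂ} (hg : Pres S g) (hh : Pres S h) {a b : ℝ}
    (ha : 0 ≤ a) (hb : 0 ≤ b) : Pres S (fun z => (a : ℂ) * g z + (b : ℂ) * h z) := by
  intro n A hA hS
  have h1 := (hg n A hA hS).smul (a := (a : ℂ)) (by exact_mod_cast ha)
  have h2 := (hh n A hA hS).smul (a := (b : ℂ)) (by exact_mod_cast hb)
  exact psd_congr (h1.add h2) fun j k => by simp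

lemma K_convex : Convex ℝ K := by
  intro f hf g hg a b ha hb hab
  refine ⟨?_, ?_, ?_⟩
  · exact hf.1.add_smul hg.1 ha hb
  · have : (a : ℂ) + b = 1 := by exact_mod_cast hab
    simpa [hf.2.1, hg.2.1] using this
  · intro z hz
    simp [hf.2.2 z hz, hg.2.2 z hz]

/-- Perturbation of `χ`. -/
noncomputable def N (χ : ℂ → ℂ) (w μ : ℂ) (z : ℂ) : ℂ :=
  χ z + (1 / 4) * (μ * χ (w * z) + starRingEnd ℂ μ * χ (starRingEnd ℂ w * z))

lemma N_pres {χ : ℂ → ℂ} (hχ : Pres CD χ) {w μ : ℂ} (hw : ‖w‖ ≤ 1) (hμ : ‖μ‖ = 1) :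
    Pres CD (N χ w μ) := by
  intro n A hA hS
  have h1 := psd_tensor hA (psd_two_by_two hw)
  have h2 := hχ.fintype h1 (fun p q => by
    rw [mem_CD, Matrix.of_apply, norm_mul]
    exact mul_le_one₀ (mem_CD.1 (hS _ _)) (norm_nonneg _) (entries_two hw _ _))
  have h3 := (psd_compress h2 ![1, μ]).smul (a := (1/4 : ℂ)) (by
    rw [show (1/4 : ℂ) = ((1/4 : ℝ) : ℂ) by norm_num]
    exact_mod_cast (by norm_num : (0:ℝ) ≤ 1/4))
  have h4 := (hχ n A hA hS).smul (a := (1/2 : ℂ)) (by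
    rw [show (1/2 : ℂ) = ((1/2 : ℝ) : ℂ) by norm_num]
    exact_mod_cast (by norm_num : (0:ℝ) ≤ 1/2))
  refine psd_congr (h3.add h4) fun j k => ?_
  have hm : starRingEnd ℂ μ * μ = 1 := by rw [Complex.conj_mul', hμ]; simp
  simp [N, Fin.sum_univ_two]
  rw [mul_comm w, mul_comm (starRingEnd ℂ w)]
  linear_combination (1/4 : ℂ) * χ (A j k) * hm

lemma extreme_aux {χ : ℂ → ℂ} (hχ : χ ∈ K.extremePoints ℝ) {w μ z : ℂ} (hw : ‖w‖ ≤ 1)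
    (hμ : ‖μ‖ = 1) (hz : ‖z‖ ≤ 1) :
    μ * χ (w * z) + starRingEnd ℂ μ * χ (starRingEnd ℂ w * z) = 2 * ((μ * χ w).re : ℂ) * χ z := by
  have hK := hχ.1
  set p : ℝ := (1 / 2) * (μ * χ w).re with hp
  have hpb : |p| ≤ 1 / 2 := by
    have h1 : |(μ * χ w).re| ≤ 1 := by
      refine (Complex.abs_re_le_norm _).trans ?_
      rw [norm_mul, hμ, one_mul]
      exact K_norm_le hK w
    rw [hp, abs_mul]
    rw [abs_of_pos (by norm_num : (0:ℝ) < 1/2)]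
    linarith
  have hN1 : ∀ ν : ℂ, N χ w ν 1 = ((1 + (1/2) * (ν * χ w).re : ℝ) : ℂ) := by
    intro ν
    have := (hK.1.two hw).2.2.2
    simp only [N, mul_one, this, hK.2.1, ← map_mul]
    rw [Complex.add_conj]
    push_cast; ring
  have hmem : ∀ (ν : ℂ) (q : ℝ), ‖ν‖ = 1 → 0 < q → N χ w ν 1 = q →
      (fun z => if ‖z‖ ≤ 1 then ((q⁻¹ : ℝ) : ℂ) * N χ w ν z else 0) ∈ K := by
    intro ν q hν hq h1
    refine ⟨?_, ?_, ?_⟩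
    · intro n A hA hS
      refine psd_congr ((N_pres hK.1 hw hν n A hA hS).smul (a := ((q⁻¹ : ℝ) : ℂ))
        (by exact_mod_cast (inv_pos.2 hq).le)) fun j k => ?_
      have := mem_CD.1 (hS j k)
      simp [this]
    · have : (q : ℂ) ≠ 0 := by exact_mod_cast hq.ne'
      simp [h1, this]
    · intro z hz
      simp [not_le.2 hz]
  rw [abs_le] at hpb
  have hq1 : 0 < 1 + p := by linarith
  have hq2 : 0 < 1 - p := by linarith
  have g1 := hmem μ (1 + p) hμ hq1 (hN1 μ)
  have g2 := hmem (-μ) (1 - p) (by simpa using hμ) hq2 (by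
    rw [hN1]; congr 1; simp [hp]; ring)
  have hq1c : (1 + p : ℂ) ≠ 0 := by exact_mod_cast hq1.ne'
  have hq2c : (1 - p : ℂ) ≠ 0 := by exact_mod_cast hq2.ne'
  have key := hχ.2 g1 g2 ⟨(1 + p) / 2, (1 - p) / 2, by linarith, by linarith, by ring, by
    ext z
    by_cases hz : ‖z‖ ≤ 1
    · simp [hz, N]
      field_simp
      ring
    · simp [hz, hK.2.2 z (not_le.1 hz)]⟩
  have k2 := congrFun key z
  simp only [hz, N, if_true] at k2
  push_cast at k2
  rw [mul_comm (starRingEnd ℂ w) z] at k2 ⊢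
  field_simp at k2
  have e : (2 : ℂ) * p = ((μ * χ w).re : ℂ) := by rw [hp]; push_cast; ring
  rw [← e]
  linear_combination k2

lemma extreme_mul {χ : ℂ → ℂ} (hχ : χ ∈ K.extremePoints ℝ) {w z : ℂ} (hw : ‖w‖ ≤ 1)
    (hz : ‖z‖ ≤ 1) : χ (w * z) = χ w * χ z := by
  have h1 := extreme_aux hχ hw (μ := 1) (by simp) hz
  have h2 := extreme_aux hχ hw (μ := Complex.I) (by simp) hz
  simp at h1 h2
  have e : χ w = ((χ w).re : ℂ) + (χ w).im * Complex.I := (Complex.re_add_im _).symm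
  rw [e]
  have : Complex.I * Complex.I = -1 := Complex.I_mul_I
  linear_combination (1/2) * h1 - (1/2) * Complex.I * h2 + (1/2) * (χ (w*z) - χ (starRingEnd ℂ w * z)) * this

end Herz

namespace Herz

/-- Right half of the open disc. -/
def U : Set ℂ := {z | 0 < z.re ∧ ‖z‖ < 1}

lemma U_open : IsOpen U := by
  have : U = {z | 0 < z.re} ∩ {z | ‖z‖ < 1} := rfl
  rw [this]
  exact (isOpen_lt continuous_const Complex.continuous_re).inter
    (isOpen_lt continuous_norm continuous_const)

/-- The function `z ^ α * conj z ^ β`. -/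
noncomputable def H (α β : ℝ) (z : ℂ) : ℂ :=
  Complex.exp (α * Complex.log z + β * starRingEnd ℂ (Complex.log z))

lemma H_sub_one {α β : ℝ} {z : ℂ} (hz : z ≠ 0) : H (α - 1) β z = H α β z / z := by
  have : z = Complex.exp (Complex.log z) := (Complex.exp_log hz).symm
  conv_rhs => rw [this]
  rw [H, H, Complex.log_exp (by simpa [Complex.log_im] using Complex.neg_pi_lt_arg z) (by simpa [Complex.log_im] using Complex.arg_le_pi z),
    ← Complex.exp_sub]
  congr 1
  push_cast; ring

lemma exists_roots : ∃ u : Fin 3 → ℂ, (∀ p, starRingEnd ℂ (u p) * u p = 1) ∧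
    u 0 + u 1 + u 2 = 0 ∧ u 0 ^ 2 + u 1 ^ 2 + u 2 ^ 2 = 0 := by
  have h3 : √3 * √3 = 3 := Real.mul_self_sqrt (by norm_num)
  refine ⟨![1, ⟨-1/2, √3/2⟩, ⟨-1/2, -√3/2⟩], ?_, ?_, ?_⟩
  · intro p
    fin_cases p
    · simp
    · apply Complex.ext <;> simp <;> nlinarith
    · apply Complex.ext <;> simp <;> nlinarith
  · apply Complex.ext <;> simp <;> ring
  · apply Complex.ext <;> simp [sq] <;> nlinarith

lemma H_deriv {α β : ℝ} {a v : ℂ} (ha : a ∈ U) :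
    HasDerivAt (fun t : ℝ => H α β (a + t * v))
      (H α β a * (α * (v / a) + β * starRingEnd ℂ (v / a))) 0 := by
  have h0 : HasDerivAt (fun t : ℝ => a + (t : ℂ) * v) v 0 := by
    have := ((Complex.ofRealCLM.hasDerivAt (x := (0:ℝ))).mul_const v).const_add a
    simpa using this
  have h1 : HasDerivAt (fun t : ℝ => Complex.log (a + (t : ℂ) * v)) (v / a) 0 := by
    have := h0.clog_real (by simpa [Complex.mem_slitPlane_iff] using Or.inl ha.1)
    simpa using this
  have h2 : HasDerivAt (fun t : ℝ => starRingEnd ℂ (Complex.log (a + (t : ℂ) * v)))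
      (starRingEnd ℂ (v / a)) 0 := by
    have := h1.star
    simpa using this
  have h3 := ((h1.const_mul (α : ℂ)).fun_add (h2.const_mul (β : ℂ))).cexp
  have e : H α β a = Complex.exp (α * Complex.log (a + ((0 : ℝ) : ℂ) * v) +
      β * starRingEnd ℂ (Complex.log (a + ((0 : ℝ) : ℂ) * v))) := by simp [H]
  rw [e]
  exact h3

lemma H_lower {α β : ℝ} (h : Pres U (H α β)) :
    0 ≤ α ∧ (α ≠ 0 → Pres U (H (α - 1) β)) := by
  obtain ⟨u, hu1, hu2, hu3⟩ := exists_roots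
  have main : ∀ n : ℕ, ∀ A : Matrix (Fin n) (Fin n) ℂ, A.PosSemidef → (∀ j k, A j k ∈ U) →
      (A.map fun z => (α : ℂ) * H (α - 1) β z).PosSemidef := by
    intro n A hA hU
    -- the family of compressed matrices
    let M : ℝ → Matrix (Fin n) (Fin n) ℂ := fun t => Matrix.of fun j k =>
      ∑ p, ∑ q, star (u p) * H α β (A j k + t * (u p * star (u q))) * u q
    have hM : ∀ᶠ t : ℝ in 𝓝[>] 0, (M t).PosSemidef := by
      have h1 : ∀ᶠ t : ℝ in 𝓝[>] 0, ∀ j k p q, A j k + t * (u p * star (u q)) ∈ U := by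
        simp only [eventually_all]
        intro j k p q
        have hc : ContinuousAt (fun t : ℝ => A j k + t * (u p * star (u q))) 0 := by fun_prop
        have := hc.eventually_mem (U_open.mem_nhds (by simpa using hU j k))
        exact this.filter_mono nhdsWithin_le_nhds
      filter_upwards [h1, self_mem_nhdsWithin] with t ht ht0
      have hB : (Matrix.of fun a b : Fin n × Fin 3 =>
          A a.1 b.1 + t * (u a.2 * star (u b.2))).PosSemidef := by
        have e1 := hA.submatrix (Prod.fst : Fin n × Fin 3 → Fin n)
        have e2 := (psd_rank_one (fun a : Fin n × Fin 3 => u a.2)).smul (a := (t : ℂ))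
          (by exact_mod_cast (le_of_lt ht0))
        exact psd_congr (e1.add e2) fun j k => by simp
      have := h.fintype hB (fun a b => ht _ _ _ _)
      exact psd_compress this u
    have hlim : ((9 : ℂ) • A.map fun z => (α : ℂ) * H (α - 1) β z).PosSemidef := by
      refine psd_limit (l := 𝓝[>] (0:ℝ)) (F := fun t => ((t⁻¹ : ℝ) : ℂ) • M t) ?_ ?_
      · filter_upwards [hM, self_mem_nhdsWithin] with t ht ht0
        exact ht.smul (by exact_mod_cast (inv_pos.2 ht0).le)
      · intro j k
        have hd : HasDerivAt (fun t : ℝ => M t j k)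
            (∑ p, ∑ q, star (u p) * (H α β (A j k) * (α * ((u p * star (u q)) / A j k) +
              β * starRingEnd ℂ ((u p * star (u q)) / A j k))) * u q) 0 := by
          simp only [M, Matrix.of_apply]
          refine HasDerivAt.fun_sum fun p _ => HasDerivAt.fun_sum fun q _ => ?_
          exact ((H_deriv (hU j k)).const_mul _).mul_const _
        have hz : M 0 j k = 0 := by
          simp only [M, Matrix.of_apply, Fin.sum_univ_three]
          simp
          have : starRingEnd ℂ (u 0) + starRingEnd ℂ (u 1) + starRingEnd ℂ (u 2) = 0 := by
            rw [← map_add, ← map_add, hu2, map_zero]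
          linear_combination H α β (A j k) * (u 0 + u 1 + u 2) * this
        have ha : A j k ≠ 0 := by
          intro h0
          have := (hU j k).1
          simp [h0] at this
        have hv : (∑ p, ∑ q, star (u p) * (H α β (A j k) * (α * ((u p * star (u q)) / A j k) +
              β * starRingEnd ℂ ((u p * star (u q)) / A j k))) * u q) =
              9 * (α * H (α - 1) β (A j k)) := by
          rw [H_sub_one ha]
          have e0 := hu1 0
          have e1 := hu1 1
          have e2 := hu1 2
          simp only [Fin.sum_univ_three, Complex.star_def, map_div₀, map_mul, Complex.conj_conj]
          have e3 : starRingEnd ℂ (u 0) * u 0 + starRingEnd ℂ (u 1) * u 1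
            + starRingEnd ℂ (u 2) * u 2 = 3 := by rw [e0, e1, e2]; norm_num
          generalize starRingEnd ℂ (u 0) = v0 at *
          generalize starRingEnd ℂ (u 1) = v1 at *
          generalize starRingEnd ℂ (u 2) = v2 at *
          generalize H α β (A j k) = X at *
          generalize starRingEnd ℂ (A j k) = y at *
          linear_combination (X * α / A j k) * (v0 * u 0 + v1 * u 1 + v2 * u 2 + 3) * e3
            + (X * β / y) * (v0 ^ 2 + v1 ^ 2 + v2 ^ 2) * hu3
        rw [hv] at hd
        have hs := hd.tendsto_slope_zero_right
        simp only [zero_add, hz, sub_zero] at hs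
        simpa using hs
    refine psd_congr (hlim.smul (a := (1/9 : ℂ)) ?_) fun j k => ?_
    · rw [show (1/9 : ℂ) = ((1/9 : ℝ) : ℂ) by norm_num]
      exact_mod_cast (by norm_num : (0:ℝ) ≤ 1/9)
    · simp
  have hα : 0 ≤ α := by
    have h1 := main 1 (Matrix.of fun _ _ => ((1/2 : ℝ) : ℂ)) (psd_congr ((psd_rank_one
      (fun _ : Fin 1 => (1:ℂ))).smul (a := ((1/2 : ℝ) : ℂ)) (by
        exact_mod_cast (by norm_num : (0:ℝ) ≤ 1/2))) fun j k => by simp)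
      (fun j k => by constructor <;> norm_num)
    have h2 := h1.diag_nonneg (i := 0)
    have e : H (α - 1) β ((1/2 : ℝ) : ℂ) = ((Real.exp ((α - 1) * Real.log (1/2) + β * Real.log (1/2)) : ℝ) : ℂ) := by
      rw [H, ← Complex.ofReal_log (by norm_num), Complex.conj_ofReal]
      push_cast
      rfl
    simp only [Matrix.map_apply, Matrix.of_apply] at h2
    rw [e, ← Complex.ofReal_mul] at h2
    have h3 : 0 ≤ α * Real.exp ((α - 1) * Real.log (1/2) + β * Real.log (1/2)) := by
      exact_mod_cast h2
    exact nonneg_of_mul_nonneg_left h3 (Real.exp_pos _)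
  refine ⟨hα, fun h0 n A hA hU => ?_⟩
  refine psd_congr ((main n A hA hU).smul (a := ((α⁻¹ : ℝ) : ℂ)) (by
    exact_mod_cast (inv_nonneg.2 hα))) fun j k => ?_
  have : (α : ℂ) ≠ 0 := by exact_mod_cast h0
  simp [this]

lemma H_swap {α β : ℝ} (h : Pres U (H α β)) : Pres U (H β α) := by
  intro n A hA hU
  have hU' : ∀ j k, A.transpose j k ∈ U := fun j k => hU k j
  refine psd_congr (h n A.transpose hA.transpose hU') fun j k => ?_
  have e : A k j = starRingEnd ℂ (A j k) := (hA.isHermitian.apply k j).symm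
  simp only [Matrix.map_apply, Matrix.transpose_apply]
  rw [e, H, H, Complex.log_conj, Complex.conj_conj, add_comm]
  intro h1
  have := (hU j k).1
  have h2 := (Complex.arg_eq_pi_iff.1 h1).1
  linarith

lemma H_nat : ∀ n : ℕ, ∀ α β : ℝ, α < n → Pres U (H α β) → ∃ k : ℕ, α = k := by
  intro n
  induction n with
  | zero =>
    intro α β h hP
    have := (H_lower hP).1
    simp at h
    linarith
  | succ n ih =>
    intro α β h hP
    by_cases h0 : α = 0
    · exact ⟨0, by simp [h0]⟩
    · obtain ⟨k, hk⟩ := ih (α - 1) β (by push_cast at h; linarith) ((H_lower hP).2 h0)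
      exact ⟨k + 1, by push_cast; linarith⟩

lemma H_nat' {α β : ℝ} (h : Pres U (H α β)) : (∃ j : ℕ, α = j) ∧ ∃ k : ℕ, β = k := by
  obtain ⟨n, hn⟩ := exists_nat_gt α
  obtain ⟨m, hm⟩ := exists_nat_gt β
  exact ⟨H_nat n α β hn h, H_nat m β α hm (H_swap h)⟩

end Herz

namespace Herz

/-- Multiplicative normalised preservers. -/
structure Mult (χ : ℂ → ℂ) : Prop where
  mem : χ ∈ K
  mul : ∀ w z : ℂ, ‖w‖ ≤ 1 → ‖z‖ ≤ 1 → χ (w * z) = χ w * χ z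

variable {χ : ℂ → ℂ}

lemma Mult.conj (h : Mult χ) {z : ℂ} (hz : ‖z‖ ≤ 1) :
    χ (starRingEnd ℂ z) = starRingEnd ℂ (χ z) := (h.mem.1.two hz).2.2.2

lemma Mult.one (h : Mult χ) : χ 1 = 1 := h.mem.2.1

lemma Mult.le (h : Mult χ) (z : ℂ) : ‖χ z‖ ≤ 1 := K_norm_le h.mem z

lemma norm_le_of {x : ℝ} (h0 : 0 ≤ x) (h1 : x ≤ 1) : ‖(x : ℂ)‖ ≤ 1 := by
  simpa [abs_of_nonneg h0] using h1

lemma Mult.real (h : Mult χ) {x : ℝ} (h0 : 0 ≤ x) (h1 : x ≤ 1) :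
    χ x = ((χ x).re : ℂ) ∧ 0 ≤ (χ x).re := by
  have hs : ‖((√x : ℝ) : ℂ)‖ ≤ 1 := norm_le_of (Real.sqrt_nonneg _) (Real.sqrt_le_one.2 h1)
  have e1 : χ x = χ (√x : ℝ) * χ (√x : ℝ) := by
    rw [← h.mul _ _ hs hs, ← Complex.ofReal_mul, Real.mul_self_sqrt h0]
  have e2 := h.conj hs
  rw [Complex.conj_ofReal] at e2
  have e3 : (χ (√x : ℝ)).im = 0 := Complex.conj_eq_iff_im.1 e2.symm
  have e4 : χ (√x : ℝ) = ((χ (√x : ℝ)).re : ℂ) := (Complex.conj_eq_iff_re.1 e2.symm).symm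
  rw [e1, e4, ← Complex.ofReal_mul]
  exact ⟨by simp, by simpa using mul_self_nonneg _⟩

/-- The restriction to reals. -/
noncomputable def phi (χ : ℂ → ℂ) (x : ℝ) : ℝ := (χ x).re

lemma Mult.phi_eq (h : Mult χ) {x : ℝ} (h0 : 0 ≤ x) (h1 : x ≤ 1) : χ x = (phi χ x : ℂ) :=
  (h.real h0 h1).1

lemma Mult.phi_nonneg (h : Mult χ) {x : ℝ} (h0 : 0 ≤ x) (h1 : x ≤ 1) : 0 ≤ phi χ x :=
  (h.real h0 h1).2

lemma Mult.phi_le_one (h : Mult χ) (x : ℝ) : phi χ x ≤ 1 :=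
  (Complex.re_le_norm _).trans (h.le _)

lemma Mult.phi_mul (h : Mult χ) {x y : ℝ} (h0 : 0 ≤ x) (h1 : x ≤ 1) (h2 : 0 ≤ y) (h3 : y ≤ 1) :
    phi χ (x * y) = phi χ x * phi χ y := by
  have := h.mul x y (norm_le_of h0 h1) (norm_le_of h2 h3)
  rw [h.phi_eq h0 h1, h.phi_eq h2 h3, ← Complex.ofReal_mul, ← Complex.ofReal_mul] at this
  rw [phi, this, Complex.ofReal_re]

lemma Mult.phi_pow (h : Mult χ) {x : ℝ} (h0 : 0 ≤ x) (h1 : x ≤ 1) (n : ℕ) :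
    phi χ (x ^ n) = phi χ x ^ n := by
  induction n with
  | zero => simp [phi, h.one]
  | succ n ih =>
    rw [pow_succ, h.phi_mul (by positivity) (pow_le_one₀ h0 h1) h0 h1, ih, pow_succ]

lemma Mult.phi_mono (h : Mult χ) {x y : ℝ} (h0 : 0 ≤ x) (hxy : x ≤ y) (h1 : y ≤ 1) :
    phi χ x ≤ phi χ y := by
  rcases eq_or_lt_of_le (h0.trans hxy) with hy | hy
  · have : x = y := by linarith
    rw [this]
  · have e : x = y * (x / y) := by field_simp
    rw [e, h.phi_mul hy.le h1 (by positivity) (by rwa [div_le_one hy])]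
    exact mul_le_of_le_one_right (h.phi_nonneg hy.le h1) (h.phi_le_one _)

lemma Mult.norm_sq (h : Mult χ) {z : ℂ} (hz : ‖z‖ ≤ 1) : ‖χ z‖ ^ 2 = phi χ (‖z‖ ^ 2) := by
  have hz' : ‖starRingEnd ℂ z‖ ≤ 1 := by simpa using hz
  have := h.mul _ _ hz' hz
  rw [h.conj hz, Complex.conj_mul', Complex.conj_mul'] at this
  rw [phi]
  push_cast
  rw [this]
  norm_cast

lemma Mult.zero_case (h : Mult χ) {r : ℝ} (h0 : 0 < r) (h1 : r < 1) (hr : phi χ r = 0) {z : ℂ}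
    (hz : ‖z‖ < 1) : χ z = 0 := by
  have hs1 : ‖z‖ ^ 2 < 1 := by nlinarith [norm_nonneg z]
  obtain ⟨n, hn⟩ := exists_pow_lt_of_lt_one h0 hs1
  have e1 := h.phi_mono (by positivity) hn.le h1.le
  rw [h.phi_pow (by positivity) hs1.le, hr] at e1
  have e2 := h.phi_nonneg (x := ‖z‖ ^ 2) (by positivity) hs1.le
  have e3 : phi χ (‖z‖ ^ 2) = 0 := by
    have : phi χ (‖z‖ ^ 2) ^ n = 0 := le_antisymm e1 (by positivity)
    exact eq_zero_of_pow_eq_zero this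
  rw [← h.norm_sq hz.le] at e3
  simpa using e3

lemma Mult.exists_exp (h : Mult χ) (hp : ∀ r : ℝ, 0 < r → r < 1 → 0 < phi χ r) :
    ∃ a : ℝ, 0 ≤ a ∧ ∀ s : ℝ, 0 ≤ s → phi χ (Real.exp (-s)) = Real.exp (-(a * s)) := by
  have hp' : ∀ s : ℝ, 0 ≤ s → 0 < phi χ (Real.exp (-s)) := by
    intro s hs
    rcases eq_or_lt_of_le hs with rfl | hs
    · simp [phi, h.one]
    · exact hp _ (Real.exp_pos _) (by simpa using hs)
  have hle : ∀ s : ℝ, 0 ≤ s → Real.exp (-s) ≤ 1 := fun s hs => by simpa using hs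
  set Λ : ℝ → ℝ := fun s => -Real.log (phi χ (Real.exp (-s))) with hΛ
  have hmono : ∀ s t : ℝ, 0 ≤ s → s ≤ t → Λ s ≤ Λ t := by
    intro s t hs hst
    have := h.phi_mono (Real.exp_pos _).le (Real.exp_le_exp.2 (neg_le_neg hst)) (hle s hs)
    have := Real.log_le_log (hp' t (hs.trans hst)) this
    simp only [hΛ]; linarith
  have hmul : ∀ (n : ℕ) (s : ℝ), 0 ≤ s → Λ (n * s) = n * Λ s := by
    intro n s hs
    simp only [hΛ]
    have e : Real.exp (-(n * s)) = Real.exp (-s) ^ n := by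
      rw [← Real.exp_nat_mul]; congr 1; ring
    rw [e, h.phi_pow (Real.exp_pos _).le (hle s hs), Real.log_pow]
    ring
  have ha : 0 ≤ Λ 1 := by
    have := Real.log_nonpos (hp' 1 zero_le_one).le (h.phi_le_one _)
    simp only [hΛ]; linarith
  refine ⟨Λ 1, ha, fun s hs => ?_⟩
  have key : ∀ n : ℕ, (n : ℝ) * |Λ s - Λ 1 * s| ≤ Λ 1 := by
    intro n
    have hns : 0 ≤ (n : ℝ) * s := by positivity
    have f1 := Nat.floor_le hns
    have f2 := (Nat.lt_floor_add_one ((n : ℝ) * s)).le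
    have g1 := hmono _ _ (by positivity) f1
    have g2 := hmono _ _ hns f2
    have m1 := hmul ⌊(n : ℝ) * s⌋₊ 1 zero_le_one
    have m2 := hmul (⌊(n : ℝ) * s⌋₊ + 1) 1 zero_le_one
    have m3 := hmul n s hs
    push_cast at m2
    rw [mul_one] at m1 m2
    rw [m1, m3] at g1
    rw [m3, m2] at g2
    rw [← abs_of_nonneg (Nat.cast_nonneg n : (0:ℝ) ≤ n), ← abs_mul, abs_le]
    constructor <;> nlinarith
  have h0 : |Λ s - Λ 1 * s| ≤ 0 := by
    by_contra hcon
    push Not at hcon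
    obtain ⟨n, hn⟩ := exists_nat_gt (Λ 1 / |Λ s - Λ 1 * s|)
    rw [div_lt_iff₀ hcon] at hn
    linarith [key n]
  have h1 : Λ s = Λ 1 * s := by
    have := abs_eq_zero.1 (le_antisymm h0 (abs_nonneg _))
    linarith
  rw [← h1]
  simp only [hΛ, neg_neg]
  rw [Real.exp_log (hp' s hs)]

/-- The `3 × 3` estimate. -/
lemma Mult.three (h : Mult χ) {θ : ℝ} (hθ : 0 ≤ Real.cos θ) :
    ‖χ (√(1/2) : ℝ) * (1 - χ (Complex.exp (θ * Complex.I)))‖ ^ 2 ≤ 2 - 2 * phi χ (Real.cos θ) := by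
  set s : ℝ := √(1/2) with hs
  have hs2 : (s : ℂ) * s = 1/2 := by
    rw [← Complex.ofReal_mul, hs, Real.mul_self_sqrt (by norm_num)]; norm_num
  have hs0 : 0 ≤ s := Real.sqrt_nonneg _
  have hs1 : s ≤ 1 := Real.sqrt_le_one.2 (by norm_num)
  set e : ℂ := Complex.exp (θ * Complex.I) with he
  have hen : ‖e‖ = 1 := Complex.norm_exp_ofReal_mul_I θ
  have hee : starRingEnd ℂ e * e = 1 := by rw [Complex.conj_mul', hen]; simp
  have hc : (Real.cos θ : ℂ) = (e + starRingEnd ℂ e) / 2 := by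
    rw [Complex.add_conj, he, Complex.exp_ofReal_mul_I_re]; push_cast; ring
  have hG : (!![1, (s : ℂ), s * e; (s : ℂ), 1, (Real.cos θ : ℂ);
      s * starRingEnd ℂ e, (Real.cos θ : ℂ), 1] : Matrix (Fin 3) (Fin 3) ℂ).PosSemidef := by
    refine psd_congr (psd_gram ![![1, 0], ![(s : ℂ), s], ![s * starRingEnd ℂ e, s * e]]) ?_
    intro j k
    rw [hc]
    fin_cases j <;> fin_cases k <;> simp
    · linear_combination 2 * hs2
    · linear_combination (e + starRingEnd ℂ e) * hs2
    · linear_combination (e + starRingEnd ℂ e) * hs2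
    · linear_combination 2 * s * s * hee + 2 * hs2
  have hse : ‖(s : ℂ) * e‖ ≤ 1 := by
    rw [norm_mul, hen, mul_one]; exact norm_le_of hs0 hs1
  have hcn : ‖(Real.cos θ : ℂ)‖ ≤ 1 := norm_le_of hθ (Real.cos_le_one θ)
  have h1 := h.mem.1.fintype hG (fun j k => by
    rw [mem_CD]
    fin_cases j <;> fin_cases k
    · simp
    · exact norm_le_of hs0 hs1
    · exact hse
    · exact norm_le_of hs0 hs1
    · simp
    · exact hcn
    · simpa using hse
    · exact hcn
    · simp)
  have e1 : χ (s * e) = χ s * χ e := h.mul _ _ (norm_le_of hs0 hs1) hen.le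
  have e2 : χ (s * starRingEnd ℂ e) = χ s * starRingEnd ℂ (χ e) := by
    rw [h.mul _ _ (norm_le_of hs0 hs1) (by simpa using hen.le), h.conj hen.le]
  have e3 := h.phi_eq hs0 hs1
  have e4 := h.phi_eq hθ (Real.cos_le_one θ)
  set D : ℂ := χ s * (1 - χ e) with hD
  have h2 := psd_iff.1 h1 ![-D, 1, -1]
  simp only [Fin.sum_univ_three, Matrix.map_apply] at h2
  simp [-Complex.ofReal_cos, -one_div] at h2
  rw [h.one, e1, e2, e3, e4] at h2
  have h3 : starRingEnd ℂ D = phi χ s * (1 - starRingEnd ℂ (χ e)) := by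
    rw [hD, map_mul, e3, Complex.conj_ofReal, map_sub, map_one]
  have h4 : D = phi χ s * (1 - χ e) := by rw [hD, e3]
  have h5 : (0 : ℂ) ≤ ((2 - 2 * phi χ (Real.cos θ) - ‖D‖ ^ 2 : ℝ) : ℂ) := by
    refine h2.trans_eq ?_
    push_cast [-Complex.ofReal_cos]
    rw [← Complex.conj_mul', h3, h4]
    ring
  have h6 : 0 ≤ 2 - 2 * phi χ (Real.cos θ) - ‖D‖ ^ 2 := by exact_mod_cast h5
  linarith

/-- Preservers cannot jump at the origin. -/
lemma Mult.at_zero (h : Mult χ) (h1 : χ (√(1/2) : ℝ) = 1) : χ 0 = 1 := by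
  set s : ℝ := √(1/2) with hs
  have hs2 : (s : ℂ) * s = 1/2 := by
    rw [← Complex.ofReal_mul, hs, Real.mul_self_sqrt (by norm_num)]; norm_num
  have hs0 : 0 ≤ s := Real.sqrt_nonneg _
  have hs1 : s ≤ 1 := Real.sqrt_le_one.2 (by norm_num)
  have hG : (!![1, (s : ℂ), 0; (s : ℂ), 1, (s : ℂ);
      0, (s : ℂ), 1] : Matrix (Fin 3) (Fin 3) ℂ).PosSemidef := by
    refine psd_congr (psd_gram ![![1, 0], ![(s : ℂ), s], ![0, 1]]) ?_
    intro j k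
    fin_cases j <;> fin_cases k <;> simp
    linear_combination 2 * hs2
  have h2 := h.mem.1.fintype hG (fun j k => by
    rw [mem_CD]
    fin_cases j <;> fin_cases k <;> simp [abs_of_nonneg hs0, hs1])
  have h3 := psd_iff.1 h2 ![1, -2, 1]
  simp only [Fin.sum_univ_three, Matrix.map_apply] at h3
  simp at h3
  rw [h1, h.one] at h3
  have e4 := h.phi_eq (x := 0) le_rfl zero_le_one
  rw [Complex.ofReal_zero] at e4
  rw [e4] at h3 ⊢
  have h5 : (0 : ℂ) ≤ ((2 * phi χ 0 - 2 : ℝ) : ℂ) := by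
    refine h3.trans_eq ?_
    push_cast; ring
  have h6 : 0 ≤ 2 * phi χ 0 - 2 := by exact_mod_cast h5
  have := h.phi_le_one 0
  have : phi χ 0 = 1 := by linarith
  rw [this]; simp

end Herz

namespace Herz

variable {χ : ℂ → ℂ}

lemma exp_char {ψ : ℝ → ℂ} (hc : Continuous ψ) (h0 : ψ 0 = 1)
    (hm : ∀ s t, ψ (s + t) = ψ s * ψ t) (hb : ∀ t, ‖ψ t‖ ≤ 1) :
    ∃ m : ℝ, ∀ t : ℝ, ψ t = Complex.exp (m * t * Complex.I) := by
  set F : ℝ → ℂ := fun t => ∫ x in (0:ℝ)..t, ψ x with hF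
  have hFd : ∀ t, HasDerivAt F (ψ t) t := fun t =>
    intervalIntegral.integral_hasDerivAt_right (hc.intervalIntegrable _ _)
      hc.aestronglyMeasurable.stronglyMeasurableAtFilter hc.continuousAt
  obtain ⟨δ, hδ⟩ : ∃ δ, F δ ≠ 0 := by
    by_contra hcon
    push Not at hcon
    have h1 : F = fun _ => 0 := funext hcon
    have h2 := hFd 0
    rw [h1, h0] at h2
    exact one_ne_zero (h2.unique (hasDerivAt_const (0:ℝ) (0:ℂ)))
  have hF0 : F 0 = 0 := by simp [hF]
  have key : ∀ t, ψ t * F δ = F (t + δ) - F t := by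
    intro t
    have e1 : ∫ x in (0:ℝ)..δ, ψ (t + x) = ψ t * F δ := by
      simp_rw [hm]
      rw [intervalIntegral.integral_const_mul]
    rw [← e1, intervalIntegral.integral_comp_add_left (fun x => ψ x) t, add_zero]
    simp only [hF]
    rw [intervalIntegral.integral_interval_sub_left (hc.intervalIntegrable _ _)
      (hc.intervalIntegrable _ _)]
  set c : ℂ := (ψ δ - 1) / F δ with hcdef
  have hψd : ∀ t, HasDerivAt ψ (c * ψ t) t := by
    intro t
    have e : ψ = fun t => (F (t + δ) - F t) / F δ := by
      funext t; rw [← key, mul_div_cancel_right₀ _ hδ]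
    have h1 : HasDerivAt (fun t => (F (t + δ) - F t) / F δ) ((ψ (t + δ) - ψ t) / F δ) t :=
      (((hFd (t + δ)).comp_add_const t δ).sub (hFd t)).div_const _
    rw [← e] at h1
    have e2 : (ψ (t + δ) - ψ t) / F δ = c * ψ t := by rw [hm, hcdef]; ring
    rwa [e2] at h1
  have hexp : ∀ t : ℝ, ψ t = Complex.exp (c * t) := by
    have hd : ∀ t : ℝ, HasDerivAt (fun t : ℝ => ψ t * Complex.exp (-(c * t))) 0 t := by
      intro t
      have h1 : HasDerivAt (fun t : ℝ => -(c * (t : ℂ))) (-(c * 1)) t :=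
        ((Complex.ofRealCLM.hasDerivAt (x := t)).const_mul c).neg
      have h2 := (hψd t).mul h1.cexp
      have e3 : c * ψ t * Complex.exp (-(c * t)) + ψ t * (Complex.exp (-(c * t)) * -(c * 1)) = 0 := by
        ring
      rw [e3] at h2
      exact h2
    intro t
    have h3 := is_const_of_deriv_eq_zero (fun t => (hd t).differentiableAt) (fun t => (hd t).deriv) t 0
    simp only [h0, Complex.ofReal_zero, mul_zero, neg_zero, Complex.exp_zero, mul_one] at h3
    rw [Complex.exp_neg, mul_inv_eq_one₀ (Complex.exp_ne_zero _)] at h3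
    exact h3
  have hre : c.re = 0 := by
    have h1 := hb 1
    have h2 := hb (-1)
    rw [hexp, Complex.norm_exp, Real.exp_le_one_iff] at h1 h2
    simp at h1 h2
    linarith
  refine ⟨c.im, fun t => ?_⟩
  rw [hexp]
  congr 1
  conv_lhs => rw [← Complex.re_add_im c, hre]
  simp; ring

lemma Mult.circle (h : Mult χ) (hp : ∀ r : ℝ, 0 < r → r < 1 → 0 < phi χ r) :
    ∃ m : ℝ, ∀ t : ℝ, χ (Complex.exp (t * Complex.I)) = Complex.exp (m * t * Complex.I) := by
  obtain ⟨a, ha, hexp⟩ := h.exists_exp hp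
  set ψ : ℝ → ℂ := fun t => χ (Complex.exp (t * Complex.I)) with hψ
  have hn : ∀ t : ℝ, ‖Complex.exp (t * Complex.I)‖ ≤ 1 := fun t =>
    (Complex.norm_exp_ofReal_mul_I t).le
  have hm : ∀ s t, ψ (s + t) = ψ s * ψ t := by
    intro s t
    simp only [hψ]
    rw [← h.mul _ _ (hn s) (hn t), ← Complex.exp_add]
    congr 2; push_cast; ring
  have h0 : ψ 0 = 1 := by simp [hψ, h.one]
  have hb : ∀ t, ‖ψ t‖ ≤ 1 := fun t => h.le _
  set q : ℝ := ‖χ (√(1/2) : ℝ)‖ with hq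
  have hs1 : √(1/2 : ℝ) < 1 := by
    rw [Real.sqrt_lt' one_pos]; norm_num
  have hs0 : 0 < √(1/2 : ℝ) := Real.sqrt_pos.2 (by norm_num)
  have hq0 : 0 < q := by
    rw [hq, h.phi_eq hs0.le hs1.le]
    simpa using (hp _ hs0 hs1).ne'
  have hlim : Tendsto ψ (𝓝 0) (𝓝 1) := by
    have t1 : Tendsto (fun θ : ℝ => (2 - 2 * Real.exp (-(a * (-Real.log (Real.cos θ))))) / q ^ 2)
        (𝓝 0) (𝓝 0) := by
      have : ContinuousAt (fun θ : ℝ =>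
          (2 - 2 * Real.exp (-(a * (-Real.log (Real.cos θ))))) / q ^ 2) 0 := by
        have : ContinuousAt (fun θ : ℝ => Real.log (Real.cos θ)) 0 :=
          ContinuousAt.log Real.continuous_cos.continuousAt (by simp)
        fun_prop
      have h2 := this.tendsto
      simpa using h2
    have t2 : Tendsto (fun θ : ℝ => ‖1 - ψ θ‖ ^ 2) (𝓝 0) (𝓝 0) := by
      refine squeeze_zero' (Eventually.of_forall fun θ => by positivity) ?_ t1
      have hev : ∀ᶠ θ : ℝ in 𝓝 0, 0 < Real.cos θ :=
        Real.continuous_cos.continuousAt.eventually (lt_mem_nhds (by simp))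
      filter_upwards [hev] with θ hθ
      have h3 := h.three hθ.le
      have h4 := hexp (-Real.log (Real.cos θ)) (by
        have := Real.log_nonpos hθ.le (Real.cos_le_one θ)
        linarith)
      rw [neg_neg, Real.exp_log hθ] at h4
      rw [h4, norm_mul, mul_pow] at h3
      rw [le_div_iff₀ (by positivity), mul_comm]
      exact h3
    have t3 : Tendsto (fun θ : ℝ => ‖1 - ψ θ‖) (𝓝 0) (𝓝 0) := by
      have := t2.sqrt
      simpa [Real.sqrt_sq] using this
    have t4 := tendsto_zero_iff_norm_tendsto_zero.2 t3
    simpa using t4.const_sub 1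
  have hc : Continuous ψ := by
    rw [continuous_iff_continuousAt]
    intro t
    have h1 : Tendsto (fun x => x - t) (𝓝 t) (𝓝 0) := by
      have : ContinuousAt (fun x => x - t) t := by fun_prop
      simpa [ContinuousAt] using this
    have h2 := (hlim.comp h1).const_mul (ψ t)
    rw [mul_one] at h2
    refine h2.congr fun x => ?_
    simp only [Function.comp]
    rw [← hm]; congr 1; ring
  exact exp_char hc h0 hm hb

lemma rep_monomial {g : ℂ → ℂ} (j k : ℕ)
    (hg : ∀ z : ℂ, ‖z‖ < 1 → g z = z ^ j * starRingEnd ℂ z ^ k) : Rep g := by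
  refine ⟨fun a b => if a = j ∧ b = k then 1 else 0, fun a b => by positivity, fun z hz => ?_⟩
  rw [hg z (by simpa using hz)]
  have := hasSum_single (f := fun p : ℕ × ℕ =>
    (((if p.1 = j ∧ p.2 = k then 1 else 0 : ℝ)) : ℂ) * z ^ p.1 * (starRingEnd ℂ z) ^ p.2) (j, k) (by
      rintro ⟨a, b⟩ hab
      have : ¬ (a = j ∧ b = k) := by rintro ⟨rfl, rfl⟩; exact hab rfl
      simp [this])
  simpa using this

lemma rep_zero {g : ℂ → ℂ} (hg : ∀ z : ℂ, ‖z‖ < 1 → g z = 0) : Rep g := by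
  refine ⟨fun _ _ => 0, fun _ _ => le_rfl, fun z hz => ?_⟩
  rw [hg z (by simpa using hz)]
  simpa using (hasSum_zero : HasSum (fun _ : ℕ × ℕ => (0:ℂ)) 0)

lemma Mult.rep (h : Mult χ) : Rep χ := by
  by_cases hp : ∀ r : ℝ, 0 < r → r < 1 → 0 < phi χ r
  swap
  · push Not at hp
    obtain ⟨r, h0, h1, hr⟩ := hp
    exact rep_zero fun z hz => h.zero_case h0 h1 (le_antisymm hr (h.phi_nonneg h0.le h1.le)) hz
  obtain ⟨a, ha, hexp⟩ := h.exists_exp hp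
  obtain ⟨m, hm⟩ := h.circle hp
  have hH : ∀ z : ℂ, z ≠ 0 → ‖z‖ < 1 → χ z = H ((a + m) / 2) ((a - m) / 2) z := by
    intro z hz hz1
    have hz0 : 0 < ‖z‖ := norm_pos_iff.2 hz
    have e1 : χ z = χ (‖z‖ : ℝ) * χ (Complex.exp (z.arg * Complex.I)) := by
      rw [← h.mul _ _ (by simpa using hz1.le) (Complex.norm_exp_ofReal_mul_I _).le,
        Complex.norm_mul_exp_arg_mul_I]
    have e2 := hexp (-Real.log ‖z‖) (by
        have := Real.log_nonpos hz0.le hz1.le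
        linarith)
    rw [neg_neg, Real.exp_log hz0] at e2
    rw [e1, hm, h.phi_eq hz0.le hz1.le, e2, Complex.ofReal_exp, ← Complex.exp_add, H]
    congr 1
    have e3 : Complex.log z = Real.log ‖z‖ + z.arg * Complex.I := rfl
    rw [e3]
    simp only [map_add, map_mul, Complex.conj_ofReal, Complex.conj_I]
    push_cast
    ring
  have hPU : Pres U (H ((a + m) / 2) ((a - m) / 2)) := by
    intro n A hA hAU
    refine psd_congr (h.mem.1 n A hA fun j k => mem_CD.2 (hAU j k).2.le) ?_
    intro j k
    have h1 := hAU j k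
    have h2 : A j k ≠ 0 := fun h3 => by
      have := h1.1
      rw [h3] at this
      simp at this
    simp only [Matrix.map_apply]
    exact hH _ h2 h1.2
  obtain ⟨⟨j, hj⟩, k, hk⟩ := H_nat' hPU
  have hmon : ∀ z : ℂ, z ≠ 0 → ‖z‖ < 1 → χ z = z ^ j * starRingEnd ℂ z ^ k := by
    intro z hz hz1
    rw [hH z hz hz1, hj, hk, H, Complex.exp_add]
    simp only [Complex.ofReal_natCast]
    rw [Complex.exp_nat_mul, Complex.exp_nat_mul, Complex.exp_log hz, Complex.exp_conj,
      Complex.exp_log hz]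
  refine rep_monomial j k fun z hz => ?_
  by_cases hz0 : z ≠ 0
  · exact hmon z hz0 hz
  push Not at hz0
  subst hz0
  by_cases hjk : j + k = 0
  · have hj0 : j = 0 := by omega
    have hk0 : k = 0 := by omega
    subst hj0 hk0
    have hs1 : √(1/2 : ℝ) < 1 := by
      rw [Real.sqrt_lt' one_pos]; norm_num
    have hs0 : 0 < √(1/2 : ℝ) := Real.sqrt_pos.2 (by norm_num)
    rw [h.at_zero]
    · simp
    · rw [hmon]
      · simp
      · exact_mod_cast hs0.ne'
      · rw [Complex.norm_real, Real.norm_of_nonneg hs0.le]; exact hs1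
  · have e4 : (0:ℂ) ^ j * starRingEnd ℂ 0 ^ k = 0 := by
      rw [map_zero, ← pow_add, zero_pow hjk]
    rw [e4]
    have e5 := h.phi_eq (x := 0) le_rfl zero_le_one
    rw [Complex.ofReal_zero] at e5
    have e6 := h.phi_nonneg (x := 0) le_rfl zero_le_one
    have e7 : ∀ r : ℝ, 0 < r → r < 1 → phi χ 0 ≤ r ^ (j + k) := by
      intro r h0 h1
      refine (h.phi_mono le_rfl h0.le h1.le).trans_eq ?_
      rw [phi, hmon r (by exact_mod_cast h0.ne') (by simpa [abs_of_pos h0] using h1),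
        Complex.conj_ofReal, ← pow_add]
      norm_cast
    have e8 : phi χ 0 ≤ 0 := by
      refine le_of_forall_pos_lt_add fun ε hε => ?_
      have hr0 : 0 < min (1/2) (ε/2) := by positivity
      have hr1 : min (1/2) (ε/2) < 1 := (min_le_left _ _).trans_lt (by norm_num)
      have := e7 _ hr0 hr1
      have h2 := pow_le_of_le_one hr0.le hr1.le hjk
      have h3 := min_le_right (1/2) (ε/2)
      linarith
    rw [e5, le_antisymm e8 e6]; simp

lemma K_rep {g : ℂ → ℂ} (hg : g ∈ K) : Rep g := by
  have h1 := closure_convexHull_extremePoints K_compact K_convex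
  rw [← h1] at hg
  have h2 : convexHull ℝ (K.extremePoints ℝ) ⊆ {f | Rep f} :=
    convexHull_min (fun χ hχ =>
      Mult.rep ⟨extremePoints_subset hχ, fun w z hw hz => extreme_mul hχ hw hz⟩) Rep.convex
  have h3 := closure_mono h2 hg
  obtain ⟨u, hu, hug⟩ := mem_closure_iff_ultrafilter.1 h3
  classical
  have hex : ∀ F : ℂ → ℂ, ∃ c : ℕ → ℕ → ℝ, (∀ j k, 0 ≤ c j k) ∧ (Rep F →
      ∀ z ∈ Metric.ball (0 : ℂ) 1, HasSum (fun p : ℕ × ℕ =>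
          (c p.1 p.2 : ℂ) * z ^ p.1 * (starRingEnd ℂ z) ^ p.2) (F z)) := by
    intro F
    by_cases hF : Rep F
    · obtain ⟨c, hc, hs⟩ := hF
      exact ⟨c, hc, fun _ => hs⟩
    · exact ⟨fun _ _ => 0, fun _ _ => le_rfl, fun h => absurd h hF⟩
  choose c hc hs using hex
  refine tannery u (fun F => F) c hc g ?_ ?_
  · intro z hz
    filter_upwards [hu] with F hF
    exact hs F hF z hz
  · intro z _
    have : Tendsto (fun F : ℂ → ℂ => F) u (𝓝 g) := hug
    exact tendsto_pi_nhds.1 this z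

lemma main {f : ℂ → ℂ} (hf : Pres (Metric.ball 0 1) f) : Rep f := by
  have hr : ∀ r : ℝ, 0 < r → r < 1 → Rep (fun z => f (r * z)) := by
    intro r h0 h1
    have hP : Pres CD (fun z => f (r * z)) := by
      intro n A hA hAC
      have hrA : (Matrix.of fun j k => (r : ℂ) * A j k).PosSemidef := by
        refine psd_iff.2 fun x => ?_
        have h2 := psd_iff.1 hA x
        have h3 : (0:ℂ) ≤ r := by exact_mod_cast h0.le
        refine (mul_nonneg h3 h2).trans_eq ?_
        simp only [Finset.mul_sum, Matrix.of_apply]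
        refine Finset.sum_congr rfl fun j _ => Finset.sum_congr rfl fun k _ => ?_
        ring
      refine psd_congr (hf n _ hrA fun j k => ?_) fun j k => ?_
      · have := mem_CD.1 (hAC j k)
        rw [mem_ball_zero_iff, Matrix.of_apply, norm_mul, Complex.norm_real,
          Real.norm_of_nonneg h0.le]
        nlinarith
      · simp
    set g : ℂ → ℂ := fun z => f (r * z) with hg
    have h2 := hP.two (w := 1) (by simp)
    have hg1 : g 1 = ((g 1).re : ℂ) := by
      apply Complex.ext <;> simp [h2.2.1]
    rcases eq_or_lt_of_le h2.1 with h3 | h3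
    · refine rep_zero fun z hz => ?_
      have := (hP.two hz.le).2.2.1
      rw [← h3] at this
      exact norm_le_zero_iff.1 this
    · set q : ℝ := (g 1).re with hq
      have hK : (fun z : ℂ => if ‖z‖ ≤ 1 then (q⁻¹ : ℂ) * g z else 0) ∈ K := by
        refine ⟨?_, ?_, ?_⟩
        · intro n A hA hAC
          have h5 : (Matrix.of fun j k => (q⁻¹ : ℂ) * g (A j k)).PosSemidef := by
            refine psd_iff.2 fun x => ?_
            have h6 := psd_iff.1 (hP n A hA hAC) x
            have h7 : (0:ℂ) ≤ (q⁻¹ : ℝ) := by exact_mod_cast (inv_pos.2 h3).le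
            refine (mul_nonneg h7 h6).trans_eq ?_
            simp only [Finset.mul_sum, Matrix.of_apply, Matrix.map_apply]
            refine Finset.sum_congr rfl fun j _ => Finset.sum_congr rfl fun k _ => ?_
            push_cast
            ring
          refine psd_congr h5 fun j k => ?_
          simp [mem_CD.1 (hAC j k)]
        · have : (q : ℂ) ≠ 0 := by exact_mod_cast h3.ne'
          simp only [norm_one, le_refl, if_true]
          rw [hg1]; exact inv_mul_cancel₀ this
        · intro z hz
          simp [not_le.2 hz]
      obtain ⟨c, hc, hs⟩ := K_rep hK
      refine ⟨fun j k => q * c j k, fun j k => mul_nonneg h3.le (hc j k), fun z hz => ?_⟩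
      have h5 := (hs z hz).mul_left (q : ℂ)
      have hz1 : ‖z‖ ≤ 1 := by simpa using (mem_ball_zero_iff.1 hz).le
      have hq0 : (q : ℂ) ≠ 0 := by exact_mod_cast h3.ne'
      simp only [hz1, if_true] at h5
      rw [mul_inv_cancel_left₀ hq0] at h5
      have e : (fun p : ℕ × ℕ => ((q * c p.1 p.2 : ℝ) : ℂ) * z ^ p.1 * (starRingEnd ℂ z) ^ p.2)
          = fun p : ℕ × ℕ => (q : ℂ) * ((c p.1 p.2 : ℂ) * z ^ p.1 * (starRingEnd ℂ z) ^ p.2) := by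
        funext p; push_cast; ring
      rw [e]; exact h5
  have hex : ∀ r : ℝ, ∃ d : ℕ → ℕ → ℝ, (∀ j k, 0 ≤ d j k) ∧ (0 < r → r < 1 →
      ∀ z : ℂ, ‖z‖ < r → HasSum (fun p : ℕ × ℕ =>
          (d p.1 p.2 : ℂ) * z ^ p.1 * (starRingEnd ℂ z) ^ p.2) (f z)) := by
    intro r
    by_cases h : 0 < r ∧ r < 1
    · obtain ⟨h0, h1⟩ := h
      obtain ⟨c, hc, hs⟩ := hr r h0 h1
      refine ⟨fun j k => c j k * (r⁻¹ ^ j * r⁻¹ ^ k), fun j k => mul_nonneg (hc j k) (by positivity),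
        fun _ _ z hz => ?_⟩
      have hr0 : (r : ℂ) ≠ 0 := by exact_mod_cast h0.ne'
      have h2 := hs ((r⁻¹ : ℝ) * z) (by
        rw [mem_ball_zero_iff, norm_mul, Complex.norm_real, Real.norm_of_nonneg (by positivity),
          inv_mul_lt_iff₀ h0, mul_one]
        exact hz)
      have e0 : (r : ℂ) * ((r⁻¹ : ℝ) * z) = z := by
        push_cast; rw [mul_inv_cancel_left₀ hr0]
      simp only [e0] at h2
      have e : (fun p : ℕ × ℕ => ((c p.1 p.2 * (r⁻¹ ^ p.1 * r⁻¹ ^ p.2) : ℝ) : ℂ) * z ^ p.1 *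
          (starRingEnd ℂ z) ^ p.2) = fun p : ℕ × ℕ => (c p.1 p.2 : ℂ) * ((r⁻¹ : ℝ) * z) ^ p.1 *
            (starRingEnd ℂ ((r⁻¹ : ℝ) * z)) ^ p.2 := by
        funext p
        rw [map_mul, Complex.conj_ofReal]
        push_cast; ring
      rw [e]; exact h2
    · exact ⟨fun _ _ => 0, fun _ _ => le_rfl, fun h0 h1 => absurd ⟨h0, h1⟩ h⟩
  choose d hd hs using hex
  refine tannery (Ultrafilter.of (𝓝[<] (1:ℝ))) (fun _ => f) d hd f ?_ ?_
  · intro z hz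
    have hz1 : ‖z‖ < 1 := mem_ball_zero_iff.1 hz
    have : ∀ᶠ r : ℝ in 𝓝[<] 1, ‖z‖ < r ∧ r < 1 := Ioo_mem_nhdsLT hz1
    filter_upwards [Ultrafilter.of_le _ this] with r hr1
    exact hs r ((norm_nonneg z).trans_lt hr1.1) hr1.2 z hr1.1
  · intro z _
    exact tendsto_const_nhds

end Herz



/-- Herz's theorem: `f : D(0,1) → ℂ` preserves positive semidefiniteness
entrywise on `P_n(D(0,1))` for all `n ≥ 1` iff
`f(z) = Σ_{j,k ≥ 0} c_{jk} z^j conj(z)^k` with all `c_{jk} ≥ 0`, the double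
series converging absolutely on the disc. -/
theorem stmt5 (f : ℂ → ℂ) :
    (∀ n : ℕ, 1 ≤ n → ∀ A : Matrix (Fin n) (Fin n) ℂ, A.PosSemidef →
        (∀ j k, A j k ∈ Metric.ball (0 : ℂ) 1) → (A.map f).PosSemidef) ↔
    (∃ c : ℕ → ℕ → ℝ, (∀ j k, 0 ≤ c j k) ∧
      ∀ z ∈ Metric.ball (0 : ℂ) 1,
        HasSum (fun p : ℕ × ℕ =>
          (c p.1 p.2 : ℂ) * z ^ p.1 * (starRingEnd ℂ z) ^ p.2) (f z)) := by
  constructor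
  · intro h
    refine Herz.main ?_
    intro n A hA hAS
    rcases Nat.eq_zero_or_pos n with rfl | hn
    · exact Herz.psd_iff.2 fun x => by simp
    · exact h n hn A hA hAS
  · intro h n _ A hA hAS
    exact Herz.Rep.pres h n A hA hAS
end
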